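/- arXiv:1312.0244 — 3 statements merged into one kernel-verified Lean document; each statement's English description precedes it below -/
import Mathlib

section
/- Define η(K) for an origin-symmetric convex body K ⊂ R^N as the infimum of ∫_{R^N} F(x) dx over nonzero continuous F with F ≥ 0 on R^N, F(0) ≥ 1, and Fourier transform vanishing outside K. Then η(K) ≤ 2^N / vol_N(K). -/
open MeasureTheory Real
open scoped FourierTransform

theorem aux_13 {N : ℕ} (K : Set (EuclideanSpace ℝ (Fin N)))
    (f : EuclideanSpace ℝ (Fin N) → ℝ) (hf : ContDiff ℝ (⊤ : ℕ∞) f) (hc : HasCompactSupport f)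
    (h01 : ∀ x, 0 ≤ f x ∧ f x ≤ 1) (hpos : 0 < ∫ x, f x)
    (hsupp : ∀ v w, f v ≠ 0 → f w ≠ 0 → v - w ∈ K) :
    ∃ F : EuclideanSpace ℝ (Fin N) → ℝ,
        Continuous F ∧ (∀ x, 0 ≤ F x) ∧ 1 ≤ F 0 ∧ F ≠ 0 ∧ Integrable F volume ∧
        (∀ ξ ∉ K, 𝓕 (fun x => (F x : ℂ)) ξ = 0) ∧ ∫ x, F x ≤ 1 / ∫ x, f x := by
  set I := ∫ x, f x with hI
  have hcd : ContDiff ℝ (⊤ : ℕ∞) (fun x => (f x : ℂ)) := Complex.ofRealCLM.contDiff.comp hf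
  have hcc : HasCompactSupport (fun x => (f x : ℂ)) :=
    hc.comp_left (g := fun t : ℝ => (t : ℂ)) (by simp)
  set φ := hcc.toSchwartzMap hcd with hφ
  have hφx : ∀ x, φ x = (f x : ℂ) := fun x => rfl
  have hint : Integrable f := hf.continuous.integrable_of_hasCompactSupport hc
  have h0 : 𝓕 φ 0 = (I : ℂ) := by
    rw [SchwartzMap.fourier_coe, Real.fourier_eq]
    simp [hφx, integral_complex_ofReal, hI]
  have hF0 : ‖𝓕 φ 0‖ ^ 2 / I ^ 2 = 1 := by
    rw [h0]
    rw [Complex.norm_real, Real.norm_eq_abs, sq_abs]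
    field_simp
  have hsq : ∀ x, ((‖𝓕 φ x‖ ^ 2 : ℝ) : ℂ) = inner ℂ (𝓕 φ x) (𝓕 φ x) := by
    intro x
    rw [inner_self_eq_norm_sq_to_K]
    simp
  have hint2 : Integrable (fun x => ‖𝓕 φ x‖ ^ 2) := by
    have := ((𝓕 φ).memLp 2 volume)
    exact this.integrable_norm_pow (by norm_num)
  refine ⟨fun x => ‖𝓕 φ x‖ ^ 2 / I ^ 2, ?_, fun x => by positivity, hF0.ge, ?_, ?_, ?_, ?_⟩
  · have := (𝓕 φ).continuous
    fun_prop
  · intro h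
    have := congrFun h 0
    simp only [hF0] at this
    simp at this
  · exact hint2.div_const _
  · intro ξ hξ
    have hcd' : ContDiff ℝ (⊤ : ℕ∞) (fun x => (f (x + -ξ) : ℂ)) :=
      hcd.comp (contDiff_id.add contDiff_const)
    have hcc' : HasCompactSupport (fun x => (f (x + -ξ) : ℂ)) :=
      hcc.comp_homeomorph (Homeomorph.addRight (-ξ))
    set ψ := hcc'.toSchwartzMap hcd' with hψ
    have hψx : ∀ x, ψ x = (f (x + -ξ) : ℂ) := fun x => rfl
    have hψF : ∀ x, 𝓕 ψ x = 𝐞 (-inner ℝ x ξ) • 𝓕 φ x := by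
      intro x
      have := congrFun (VectorFourier.fourierIntegral_comp_add_right 𝐞
        (volume : Measure (EuclideanSpace ℝ (Fin N))) (innerₗ _) (fun x => (f x : ℂ)) (-ξ)) x
      have e : -inner ℝ x ξ = innerₗ (EuclideanSpace ℝ (Fin N)) (-ξ) x := by
        simp [real_inner_comm]
      rw [e]
      exact this
    have key := SchwartzMap.integral_inner_fourier_fourier φ ψ
    have hz : ∫ x, inner ℂ (φ x) (ψ x) = 0 := by
      rw [← integral_zero (EuclideanSpace ℝ (Fin N)) ℂ]
      congr 1
      ext v
      rw [hφx, hψx]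
      by_cases h1 : f v = 0
      · simp [h1]
      by_cases h2 : f (v + -ξ) = 0
      · simp [h2]
      exact absurd (by simpa using hsupp _ _ h1 h2) hξ
    rw [hz] at key
    rw [Real.fourier_eq]
    calc _ = ∫ x, inner ℂ (𝓕 φ x) (𝓕 ψ x) * ((I : ℂ) ^ 2)⁻¹ := by
          congr 1
          ext x
          rw [hψF x, Complex.ofReal_div, hsq, Circle.smul_def, Circle.smul_def, inner_smul_right]
          simp only [smul_eq_mul]
          push_cast
          ring
      _ = 0 := by rw [integral_mul_const, key, zero_mul]
  · rw [integral_div, SchwartzMap.integral_norm_sq_fourier]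
    have : ∫ x, ‖φ x‖ ^ 2 ≤ I := by
      apply integral_mono (((φ).memLp 2 volume).integrable_norm_pow (by norm_num)) hint
      intro x
      have := h01 x
      simp only [hφx, Complex.norm_real, Real.norm_eq_abs, sq_abs]
      nlinarith
    calc _ ≤ I / I ^ 2 := by gcongr
      _ = 1 / I := by field_simp

section Aux

open scoped Pointwise

theorem main_13 {N : ℕ} 
    (K : Set (EuclideanSpace ℝ (Fin N)))
    (hK_compact : IsCompact K) (hK_conv : Convex ℝ K)
    (hK_int : (interior K).Nonempty) (hK_symm : ∀ x ∈ K, -x ∈ K) :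
    sInf {t : ℝ | ∃ F : EuclideanSpace ℝ (Fin N) → ℝ,
        Continuous F ∧ (∀ x, 0 ≤ F x) ∧ 1 ≤ F 0 ∧ F ≠ 0 ∧ Integrable F volume ∧
        (∀ ξ ∉ K, 𝓕 (fun x => (F x : ℂ)) ξ = 0) ∧ t = ∫ x, F x}
      ≤ 2 ^ N / (volume K).toReal := by
  have hbdd : BddBelow {t : ℝ | ∃ F : EuclideanSpace ℝ (Fin N) → ℝ,
        Continuous F ∧ (∀ x, 0 ≤ F x) ∧ 1 ≤ F 0 ∧ F ≠ 0 ∧ Integrable F volume ∧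
        (∀ ξ ∉ K, 𝓕 (fun x => (F x : ℂ)) ξ = 0) ∧ t = ∫ x, F x} := by
    refine ⟨0, ?_⟩
    rintro t ⟨F, -, h, -, -, -, -, rfl⟩
    exact integral_nonneg h
  set S := sInf {t : ℝ | ∃ F : EuclideanSpace ℝ (Fin N) → ℝ,
        Continuous F ∧ (∀ x, 0 ≤ F x) ∧ 1 ≤ F 0 ∧ F ≠ 0 ∧ Integrable F volume ∧
        (∀ ξ ∉ K, 𝓕 (fun x => (F x : ℂ)) ξ = 0) ∧ t = ∫ x, F x} with hS
  have hVtop : volume K ≠ ⊤ := hK_compact.measure_lt_top.ne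
  have hVpos : 0 < (volume K).toReal :=
    ENNReal.toReal_pos (Measure.measure_pos_of_nonempty_interior _ hK_int).ne' hVtop
  have hvolU : volume (interior K) = volume K :=
    measure_congr (interior_ae_eq_of_null_frontier (hK_conv.addHaar_frontier volume))
  let A : Set (EuclideanSpace ℝ (Fin N)) := (2⁻¹ : ℝ) • interior K
  have hAopen : IsOpen A := isOpen_interior.smul₀ (by norm_num)
  have hAvol : volume A = ENNReal.ofReal ((volume K).toReal / 2 ^ N) := by
    rw [Measure.addHaar_smul, hvolU, ENNReal.ofReal_div_of_pos (by positivity),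
      ENNReal.ofReal_toReal hVtop, finrank_euclideanSpace_fin, abs_of_nonneg (by positivity),
      mul_comm, inv_pow, ENNReal.ofReal_inv_of_pos (by positivity)]
    rfl
  have main : ∀ r : ℝ, 0 < r → r < (volume K).toReal / 2 ^ N → S ≤ 1 / r := by
    intro r hr hrV
    have : ENNReal.ofReal r < volume A := by
      rw [hAvol]
      exact (ENNReal.ofReal_lt_ofReal_iff (by positivity)).2 hrV
    obtain ⟨C, hCA, hC, hrC⟩ := hAopen.exists_lt_isCompact this
    obtain ⟨f, hfd, hfr, hfs, hf1⟩ := exists_contMDiff_support_eq_eq_one_iff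
      (n := (⊤ : ℕ∞)) (modelWithCornersSelf ℝ (EuclideanSpace ℝ (Fin N)))
      hAopen hC.isClosed hCA
    have hfd' : ContDiff ℝ (⊤ : ℕ∞) f := hfd.contDiff
    have h01 : ∀ x, 0 ≤ f x ∧ f x ≤ 1 := fun x => hfr ⟨x, rfl⟩
    have hfc : HasCompactSupport f := by
      refine HasCompactSupport.of_support_subset_isCompact (hK_compact.smul (2⁻¹ : ℝ)) ?_
      rw [hfs]
      exact Set.smul_set_mono interior_subset
    have hint : Integrable f := hfd'.continuous.integrable_of_hasCompactSupport hfc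
    have hCr : r ≤ ∫ x, f x := by
      have h1 : r ≤ (volume C).toReal := by
        rw [← ENNReal.ofReal_le_iff_le_toReal hC.measure_lt_top.ne]
        exact hrC.le
      have h2 : (volume C).toReal = ∫ x, C.indicator (fun _ => (1 : ℝ)) x := by
        rw [integral_indicator hC.measurableSet]
        simp [Measure.real]
      rw [h2] at h1
      refine h1.trans (integral_mono ?_ hint ?_)
      · rw [integrable_indicator_iff hC.measurableSet]
        exact integrableOn_const hC.measure_lt_top.ne
      · intro x
        by_cases hx : x ∈ C
        · simp [hx, (hf1 x).1 hx]
        · simp [hx, (h01 x).1]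
    obtain ⟨F, a1, a2, a3, a4, a5, a6, a7⟩ := aux_13 K f hfd' hfc h01 (hr.trans_le hCr) (by
      intro v w hv hw
      have hv' : v ∈ A := hfs ▸ hv
      have hw' : w ∈ A := hfs ▸ hw
      obtain ⟨a, ha, rfl⟩ := hv'
      obtain ⟨b, hb, rfl⟩ := hw'
      have hb' : -b ∈ K := hK_symm _ (interior_subset hb)
      have := hK_conv (interior_subset ha) hb' (a := 2⁻¹) (b := 2⁻¹)
        (by norm_num) (by norm_num) (by norm_num)
      simpa [sub_eq_add_neg] using this)
    refine (csInf_le hbdd ⟨F, a1, a2, a3, a4, a5, a6, rfl⟩).trans (a7.trans ?_)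
    exact one_div_le_one_div_of_le hr hCr
  have hVN : 0 < (volume K).toReal / 2 ^ N := by positivity
  by_contra! hlt
  have hSpos : 0 < S := lt_trans (by positivity) hlt
  have h1 : 1 / S < (volume K).toReal / 2 ^ N := by
    rw [div_lt_iff₀ hVpos] at hlt
    rw [div_lt_div_iff₀ hSpos (by positivity)]
    linarith
  obtain ⟨r, hr1, hr2⟩ := exists_between h1
  have hr0 : 0 < r := lt_trans (by positivity) hr1
  have := main r hr0 hr2
  rw [le_div_iff₀ hr0] at this
  rw [div_lt_iff₀ hSpos] at hr1
  linarith

end Aux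

/-- `η(K) ≤ 2^N / vol(K)` where `η(K)` is the infimum of `∫ F` over nonzero
continuous `F ≥ 0` with `F(0) ≥ 1` and Fourier transform vanishing outside `K`. -/
theorem stmt_13 {N : ℕ} (hN : 0 < N)
    (K : Set (EuclideanSpace ℝ (Fin N)))
    (hK_compact : IsCompact K) (hK_conv : Convex ℝ K)
    (hK_int : (interior K).Nonempty) (hK_symm : K = -K) :
    sInf {t : ℝ | ∃ F : EuclideanSpace ℝ (Fin N) → ℝ,
        Continuous F ∧ (∀ x, 0 ≤ F x) ∧ 1 ≤ F 0 ∧ F ≠ 0 ∧ Integrable F volume ∧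
        (∀ ξ ∉ K, 𝓕 (fun x => (F x : ℂ)) ξ = 0) ∧ t = ∫ x, F x}
      ≤ 2 ^ N / (volume K).toReal := by
  refine main_13 K hK_compact hK_conv hK_int ?_
  intro x hx
  rw [hK_symm] at hx
  exact Set.mem_neg.1 hx
end

section
/- Let Q = [−1,1]^N and let F : R^N → [0,∞) be a nonzero continuous integrable function with F(0) ≥ 1 whose Fourier transform vanishes outside Q. Then ∫_{R^N} F(x) dx ≥ 1, i.e. η(Q) ≥ 1. Moreover the function F(x) = ∏_{n=1}^N (sin(π x_n)/(π x_n))² is admissible and has integral exactly 1, so η(Q) = 1 = 2^N/vol_N(Q). -/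
open MeasureTheory Real
open scoped FourierTransform

noncomputable def tri14 (t : ℝ) : ℝ := max 0 (1 - |t|)

lemma tri14_cont : Continuous tri14 := by unfold tri14; fun_prop

lemma tri14_zero {t : ℝ} (h : 1 ≤ |t|) : tri14 t = 0 := by
  unfold tri14; exact max_eq_left (by linarith)

lemma tri14_compact : HasCompactSupport tri14 := by
  refine HasCompactSupport.intro (isCompact_Icc (a := (-1:ℝ)) (b := 1)) ?_
  intro x hx
  apply tri14_zero
  by_contra h
  push Not at h
  exact hx ⟨by linarith [(abs_lt.1 h).1], by linarith [(abs_lt.1 h).2]⟩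

lemma tri14_fourier (w : ℝ) (hw : w ≠ 0) :
    𝓕 (fun t => (tri14 t : ℂ)) w = ((sinc (π * w) ^ 2 : ℝ) : ℂ) := by
  rw [Real.fourier_real_eq_integral_exp_smul]
  set k : ℂ := ((-2 * π * w : ℝ) : ℂ) * Complex.I with hk
  have hk0 : k ≠ 0 := by
    simp [hk, hw, pi_ne_zero]
  have h1 : ∀ t : ℝ, Complex.exp (↑(-2 * π * t * w) * Complex.I) • (tri14 t : ℂ)
      = Complex.exp (k * t) * (tri14 t : ℂ) := by
    intro t
    rw [smul_eq_mul, hk]; congr 2; push_cast; ring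
  simp_rw [h1]
  have hsupp : Function.support (fun t : ℝ => Complex.exp (k * t) * (tri14 t : ℂ)) ⊆ Set.Ioc (-1) 1 := by
    intro t ht
    by_contra h
    apply ht
    have : tri14 t = 0 := by
      apply tri14_zero
      by_contra h'
      push Not at h'
      exact h ⟨by linarith [(abs_lt.1 h').1], by linarith [(abs_lt.1 h').2]⟩
    simp [this]
  rw [← intervalIntegral.integral_eq_integral_of_support_subset hsupp]
  have hc : Continuous (fun t : ℝ => Complex.exp (k * t) * (tri14 t : ℂ)) := by
    have := tri14_cont
    fun_prop
  rw [← intervalIntegral.integral_add_adjacent_intervals (b := 0)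
    (hc.intervalIntegrable _ _) (hc.intervalIntegrable _ _)]
  have he : ∀ t : ℝ, HasDerivAt (fun t : ℝ => Complex.exp (k * t)) (Complex.exp (k * t) * k) t := by
    intro t
    have := ((hasDerivAt_id (t:ℂ)).const_mul k).cexp.comp_ofReal
    simpa using this
  have hid : ∀ t : ℝ, HasDerivAt (fun t : ℝ => (t : ℂ)) 1 t := fun t => by
    simpa using (hasDerivAt_id (t:ℂ)).comp_ofReal
  have I2 : ∫ t in (0:ℝ)..1, Complex.exp (k * t) * (tri14 t : ℂ)
      = Complex.exp k / k^2 - 1 / k - 1 / k^2 := by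
    rw [intervalIntegral.integral_eq_sub_of_hasDerivAt
      (f := fun t : ℝ => (1 - (t:ℂ)) * Complex.exp (k * t) / k + Complex.exp (k * t) / k^2)]
    · simp; ring
    · intro t ht
      rw [Set.uIcc_of_le (by norm_num)] at ht
      have : tri14 t = 1 - t := by
        unfold tri14; rw [abs_of_nonneg ht.1]; exact max_eq_right (by linarith [ht.2])
      rw [this]
      have := ((((hid t).const_sub 1).mul (he t)).div_const k).add ((he t).div_const (k^2))
      refine this.congr_deriv ?_
      push_cast; field_simp; ring
    · exact hc.intervalIntegrable _ _
  have I1 : ∫ t in (-1:ℝ)..0, Complex.exp (k * t) * (tri14 t : ℂ)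
      = Complex.exp (-k) / k^2 + 1 / k - 1 / k^2 := by
    rw [intervalIntegral.integral_eq_sub_of_hasDerivAt
      (f := fun t : ℝ => (1 + (t:ℂ)) * Complex.exp (k * t) / k - Complex.exp (k * t) / k^2)]
    · simp; ring
    · intro t ht
      rw [Set.uIcc_of_le (by norm_num)] at ht
      have : tri14 t = 1 + t := by
        unfold tri14; rw [abs_of_nonpos ht.2, sub_neg_eq_add]; exact max_eq_right (by linarith [ht.1])
      rw [this]
      have := ((((hid t).const_add 1).mul (he t)).div_const k).sub ((he t).div_const (k^2))
      refine this.congr_deriv ?_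
      push_cast; field_simp; ring
    · exact hc.intervalIntegrable _ _
  rw [I1, I2, sinc_of_ne_zero (by simp [hw, pi_ne_zero])]
  have e1 : Complex.exp k + Complex.exp (-k) = ((2 * Real.cos (2 * (π * w)) : ℝ) : ℂ) := by
    push_cast
    rw [Complex.two_cos, hk]; push_cast
    rw [add_comm]; congr 2 <;> ring
  have e2 : k ^ 2 = ((-(4 * (π * w)^2) : ℝ) : ℂ) := by
    rw [hk, mul_pow, Complex.I_sq]; push_cast; ring
  have e3 : Complex.exp (-k) / k ^ 2 + 1 / k - 1 / k ^ 2 + (Complex.exp k / k ^ 2 - 1 / k - 1 / k ^ 2)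
    = ((Complex.exp k + Complex.exp (-k)) - 2) / k^2 := by ring
  rw [e3, e1, e2, Real.cos_two_mul, Real.cos_sq']
  norm_cast
  have : π * w ≠ 0 := by simp [hw, pi_ne_zero]
  field_simp
  ring

lemma sinc14_bound (x : ℝ) : sinc (π * x) ^ 2 ≤ 2 * (1 + x ^ 2)⁻¹ := by
  rw [← div_eq_mul_inv, le_div_iff₀ (by positivity)]
  have h1 : sinc (π * x) ^ 2 ≤ 1 := by
    rw [sq_le_one_iff_abs_le_one]; exact abs_sinc_le_one _
  have h2 : sinc (π * x) ^ 2 * x ^ 2 ≤ 1 := by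
    by_cases hx : x = 0
    · simp [hx]
    · have hp : π * x ≠ 0 := by simp [hx, pi_ne_zero]
      have : sinc (π * x) ^ 2 * x ^ 2 = sin (π * x) ^ 2 / π ^ 2 := by
        rw [sinc_of_ne_zero hp]; have := pi_ne_zero; field_simp
      rw [this, div_le_one (by positivity)]
      have := sin_sq_le_one (π * x)
      nlinarith [pi_gt_three]
  linarith [mul_add (sinc (π * x) ^ 2) 1 (x^2)]

lemma sinc14_cont : Continuous (fun x : ℝ => sinc (π * x) ^ 2) := by
  have := continuous_sinc
  fun_prop

lemma sinc14_int : Integrable (fun x : ℝ => sinc (π * x) ^ 2) := by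
  refine (integrable_inv_one_add_sq.const_mul 2).mono' sinc14_cont.aestronglyMeasurable ?_
  filter_upwards with x
  rw [Real.norm_eq_abs, abs_of_nonneg (sq_nonneg _)]
  exact sinc14_bound x

lemma sinc14_fourier (w : ℝ) :
    𝓕 (fun x : ℝ => ((sinc (π * x) ^ 2 : ℝ) : ℂ)) w = (tri14 w : ℂ) := by
  have hae : 𝓕 (fun t => (tri14 t : ℂ)) =ᵐ[volume] (fun x : ℝ => ((sinc (π * x) ^ 2 : ℝ) : ℂ)) := by
    have : ∀ᵐ x : ℝ, x ≠ 0 := by simp [ae_iff, measure_singleton]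
    filter_upwards [this] with x hx using tri14_fourier x hx
  have hi : Integrable (𝓕 (fun t => (tri14 t : ℂ))) := sinc14_int.ofReal.congr hae.symm
  have hT : Continuous (fun t => (tri14 t : ℂ)) := Complex.continuous_ofReal.comp tri14_cont
  have hTi : Integrable (fun t => (tri14 t : ℂ)) :=
    (tri14_cont.integrable_of_hasCompactSupport tri14_compact).ofReal
  have h := congrFun (hT.fourierInv_fourier_eq hTi hi) (-w)
  rw [Real.fourierInv_congr_ae hae, fourierInv_eq_fourier_neg, neg_neg] at h
  rw [h]; simp [tri14]

lemma int_prod14 {𝕜 : Type*} [RCLike 𝕜] {N : ℕ} (f : Fin N → ℝ → 𝕜) :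
    ∫ x : EuclideanSpace ℝ (Fin N), ∏ i, f i (x i) = ∏ i, ∫ t, f i t := by
  rw [← integral_fintype_prod_volume_eq_prod]
  exact (EuclideanSpace.volume_preserving_symm_measurableEquiv_toLp (Fin N)).integral_comp'
    (fun y : Fin N → ℝ => ∏ i, f i (y i))

lemma integrable_prod14 {𝕜 : Type*} [RCLike 𝕜] {N : ℕ} (f : Fin N → ℝ → 𝕜)
    (hf : ∀ i, Integrable (f i)) :
    Integrable (fun x : EuclideanSpace ℝ (Fin N) => ∏ i, f i (x i)) := by
  exact (EuclideanSpace.volume_preserving_symm_measurableEquiv_toLp (Fin N)).integrable_comp_of_integrable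
    (Integrable.fintype_prod hf)

lemma fourier_prod14 {N : ℕ} (f : ℝ → ℝ) (ξ : EuclideanSpace ℝ (Fin N)) :
    𝓕 (fun x : EuclideanSpace ℝ (Fin N) => ((∏ i, f (x i) : ℝ) : ℂ)) ξ
      = ∏ i, 𝓕 (fun t : ℝ => (f t : ℂ)) (ξ i) := by
  simp_rw [Real.fourier_real_eq_integral_exp_smul]
  rw [Real.fourier_eq', ← int_prod14]
  congr 1
  ext x
  simp only [smul_eq_mul, Finset.prod_mul_distrib, Complex.ofReal_prod]
  rw [← Complex.exp_sum]
  congr 2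
  simp only [PiLp.inner_apply, RCLike.inner_apply, conj_trivial]
  push_cast
  rw [Finset.mul_sum, Finset.sum_mul]
  exact Finset.sum_congr rfl fun i _ => by ring

lemma cube_vol14 {N : ℕ} (r : ℝ) (hr : 0 ≤ r) :
    volume {x : EuclideanSpace ℝ (Fin N) | ∀ i, |x i| ≤ r} = ENNReal.ofReal (2 * r) ^ N := by
  have h : {x : EuclideanSpace ℝ (Fin N) | ∀ i, |x i| ≤ r}
      = (MeasurableEquiv.toLp 2 (Fin N → ℝ)).symm ⁻¹' (Set.univ.pi fun _ => Set.Icc (-r) r) := by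
    ext x; simp only [← Set.pi_univ_Icc, Set.mem_preimage, Set.mem_pi, Set.mem_univ, true_imp_iff, Set.mem_Icc, ← abs_le]; rfl
  rw [h, (EuclideanSpace.volume_preserving_symm_measurableEquiv_toLp (Fin N)).measure_preimage_equiv,
    volume_pi_pi]
  simp [two_mul]

lemma cube_compact14 {N : ℕ} (r : ℝ) :
    IsCompact {x : EuclideanSpace ℝ (Fin N) | ∀ i, |x i| ≤ r} := by
  have h : {x : EuclideanSpace ℝ (Fin N) | ∀ i, |x i| ≤ r}
      = (PiLp.homeomorph 2 (fun _ : Fin N => ℝ)) ⁻¹' (Set.univ.pi fun _ => Set.Icc (-r) r) := by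
    ext x; simp only [← Set.pi_univ_Icc, Set.mem_preimage, Set.mem_pi, Set.mem_univ, true_imp_iff, Set.mem_Icc, ← abs_le]; rfl
  rw [h, Homeomorph.isCompact_preimage]
  exact isCompact_univ_pi fun _ => isCompact_Icc

/-- expansion of the kernel -/
lemma cos_expand14 (n : ℕ) (x : ℝ) :
    (((cos (π * x) ^ 2) ^ n : ℝ) : ℂ) = ∑ k ∈ Finset.range (2 * n + 1),
      ((2 * n).choose k / 4 ^ n : ℂ) * Complex.exp (2 * π * (k - n : ℂ) * x * Complex.I) := by
  rw [← pow_mul]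
  push_cast
  rw [Complex.cos, div_pow, add_pow, Finset.sum_div]
  refine Finset.sum_congr rfl fun k hk => ?_
  have hk' : k ≤ 2 * n := by simpa [Nat.lt_succ_iff] using hk
  rw [← Complex.exp_nat_mul, ← Complex.exp_nat_mul, ← Complex.exp_add, Nat.cast_sub hk', pow_mul]
  have : (k * (π * x * Complex.I) + ((2 * n : ℕ) - k : ℂ) * (-(π * x) * Complex.I) : ℂ)
    = 2 * π * (k - n : ℂ) * x * Complex.I := by push_cast; ring
  rw [this]
  norm_num
  ring

lemma exp_int14 (m : ℤ) :
    ∫ x in (-(1/2):ℝ)..(1/2), Complex.exp (2 * π * (m : ℂ) * x * Complex.I) = if m = 0 then 1 else 0 := by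
  split_ifs with h
  · simp [h]; norm_num
  · have hc : (2 * π * m * Complex.I : ℂ) ≠ 0 := by
      simp [h, pi_ne_zero]
    have : ∀ x : ℝ, (2 * π * (m : ℂ) * x * Complex.I) = (2 * π * m * Complex.I : ℂ) * x := fun x => by ring
    simp_rw [this]
    rw [integral_exp_mul_complex hc]
    have e : Complex.exp (2 * π * m * Complex.I * ((1/2 : ℝ) : ℂ))
        = Complex.exp (2 * π * m * Complex.I * ((-(1/2) : ℝ) : ℂ)) := by
      rw [Complex.exp_eq_exp_iff_exists_int]
      exact ⟨m, by push_cast; ring⟩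
    rw [e]; simp

lemma cos_int14 (n : ℕ) :
    ∫ x in (-(1/2):ℝ)..(1/2), (cos (π * x) ^ 2) ^ n = ((2 * n).choose n / 4 ^ n : ℝ) := by
  have : ((∫ x in (-(1/2):ℝ)..(1/2), (cos (π * x) ^ 2) ^ n : ℝ) : ℂ)
      = (((2 * n).choose n / 4 ^ n : ℝ) : ℂ) := by
    rw [← intervalIntegral.integral_ofReal]
    simp_rw [cos_expand14]
    rw [intervalIntegral.integral_finsetSum]
    · simp_rw [intervalIntegral.integral_const_mul]
      have h : ∀ k : ℕ, ∫ x in (-(1/2):ℝ)..(1/2), Complex.exp (2 * π * (k - n : ℂ) * x * Complex.I)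
          = if k = n then 1 else 0 := by
        intro k
        have := exp_int14 ((k : ℤ) - n)
        push_cast at this
        rw [this]
        simp [sub_eq_zero]
      simp_rw [h]
      rw [Finset.sum_eq_single n]
      · simp
      · intro b _ hb; simp [hb]
      · intro h; exact absurd (Finset.mem_range.2 (by omega)) h
    · intro k _
      exact Continuous.intervalIntegrable (by fun_prop) _ _
  exact_mod_cast this

lemma cube_int14 {N : ℕ} (n : ℕ) :
    ∫ x in {x : EuclideanSpace ℝ (Fin N) | ∀ i, |x i| ≤ 1/2}, (∏ i, cos (π * x i) ^ 2) ^ n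
      = ((2 * n).choose n / 4 ^ n : ℝ) ^ N := by
  rw [← integral_indicator (cube_compact14 _).measurableSet]
  have : ∀ x : EuclideanSpace ℝ (Fin N),
      Set.indicator {x : EuclideanSpace ℝ (Fin N) | ∀ i, |x i| ≤ 1/2}
        (fun x => (∏ i, cos (π * x i) ^ 2) ^ n) x
      = ∏ i, Set.indicator (Set.Icc (-(1/2)) (1/2)) (fun t : ℝ => (cos (π * t) ^ 2) ^ n) (x i) := by
    intro x
    by_cases hx : ∀ i, |x i| ≤ 1/2
    · rw [Set.indicator_of_mem (by exact hx), ← Finset.prod_pow]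
      refine Finset.prod_congr rfl fun i _ => ?_
      rw [Set.indicator_of_mem (Set.mem_Icc.2 (abs_le.1 (hx i)))]
    · rw [Set.indicator_of_notMem (by exact hx)]
      push Not at hx
      obtain ⟨i, hi⟩ := hx
      refine (Finset.prod_eq_zero (Finset.mem_univ i) ?_).symm
      rw [Set.indicator_of_notMem]
      intro h; exact absurd (abs_le.2 h) (not_le.2 hi)
  simp_rw [this]
  rw [int_prod14 (fun _ => Set.indicator (Set.Icc (-(1/2)) (1/2)) (fun t : ℝ => (cos (π * t) ^ 2) ^ n))]
  rw [integral_indicator measurableSet_Icc, integral_Icc_eq_integral_Ioc,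
    ← intervalIntegral.integral_of_le (by norm_num), cos_int14]
  rw [Finset.prod_const, Finset.card_univ, Fintype.card_fin]

lemma fourier_vanish14 {N : ℕ} (F : EuclideanSpace ℝ (Fin N) → ℝ) (hi : Integrable F)
    (hF : ∀ ξ ∉ {x : EuclideanSpace ℝ (Fin N) | ∀ i, |x i| ≤ 1}, 𝓕 (fun x => (F x : ℂ)) ξ = 0)
    (ξ : EuclideanSpace ℝ (Fin N)) (i : Fin N) (h : 1 ≤ |ξ i|) :
    𝓕 (fun x => (F x : ℂ)) ξ = 0 := by
  have hc : Continuous (𝓕 (fun x => (F x : ℂ))) :=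
    VectorFourier.fourierIntegral_continuous Real.continuous_fourierChar
      (by exact continuous_inner) hi.ofReal
  have ht : Filter.Tendsto (fun j : ℕ => ((1 + 1 / ((j : ℝ) + 1)) • ξ)) Filter.atTop (nhds ξ) := by
    have := (tendsto_one_div_add_atTop_nhds_zero_nat (𝕜 := ℝ)).const_add 1
    simpa using this.smul_const ξ
  have h2 := (hc.tendsto ξ).comp ht
  refine tendsto_nhds_unique h2 ?_
  refine Filter.Tendsto.congr (fun j => ?_) tendsto_const_nhds
  symm
  apply hF
  intro hq
  have := hq i
  simp only [PiLp.smul_apply, smul_eq_mul, abs_mul] at this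
  have hp : (0:ℝ) < 1 / ((j : ℝ) + 1) := by positivity
  rw [abs_of_pos (by linarith)] at this
  nlinarith

lemma full_int14 {N : ℕ} (F : EuclideanSpace ℝ (Fin N) → ℝ) (hi : Integrable F)
    (hF : ∀ ξ ∉ {x : EuclideanSpace ℝ (Fin N) | ∀ i, |x i| ≤ 1}, 𝓕 (fun x => (F x : ℂ)) ξ = 0)
    (n : ℕ) :
    ∫ x, (∏ i, cos (π * x i) ^ 2) ^ n * F x = ((2 * n).choose n / 4 ^ n : ℝ) ^ N * ∫ x, F x := by
  have key : ((∫ x, (∏ i, cos (π * x i) ^ 2) ^ n * F x : ℝ) : ℂ)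
      = ((((2 * n).choose n / 4 ^ n : ℝ) ^ N * ∫ x, F x : ℝ) : ℂ) := by
    rw [← integral_complex_ofReal]
    let m : (Fin N → ℕ) → EuclideanSpace ℝ (Fin N) := fun k => WithLp.toLp 2 (fun i => (n : ℝ) - k i)
    have e1 : ∀ x : EuclideanSpace ℝ (Fin N),
        (((∏ i, cos (π * x i) ^ 2) ^ n * F x : ℝ) : ℂ)
        = ∑ k ∈ Fintype.piFinset (fun _ : Fin N => Finset.range (2 * n + 1)),
          (∏ i, ((2 * n).choose (k i) / 4 ^ n : ℂ)) *
            (Complex.exp ((↑(-2 * π * inner ℝ x (m k)) * Complex.I)) • (F x : ℂ)) := by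
      intro x
      rw [← Finset.prod_pow, Complex.ofReal_mul, Complex.ofReal_prod]
      simp_rw [cos_expand14]
      rw [Finset.prod_univ_sum, Finset.sum_mul]
      refine Finset.sum_congr rfl fun k _ => ?_
      rw [Finset.prod_mul_distrib, ← Complex.exp_sum, smul_eq_mul, mul_assoc]
      congr 3
      simp only [m, PiLp.inner_apply, RCLike.inner_apply, conj_trivial]
      push_cast
      rw [Finset.mul_sum, Finset.sum_mul]
      exact Finset.sum_congr rfl fun i _ => by ring
    have hint : ∀ k, Integrable (fun x : EuclideanSpace ℝ (Fin N) =>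
        Complex.exp ((↑(-2 * π * inner ℝ x (m k)) * Complex.I)) • (F x : ℂ)) := by
      intro k
      have := (Real.fourierIntegral_convergent_iff (μ := volume) (f := fun x => (F x : ℂ)) (m k)).2 hi.ofReal
      simpa only [Circle.smul_def, Real.fourierChar_apply, mul_neg, neg_mul] using this
    simp_rw [e1]
    rw [integral_finsetSum _ (fun k _ => (hint k).const_mul _)]
    simp_rw [integral_const_mul, ← Real.fourier_eq']
    rw [Finset.sum_eq_single (fun _ => n)]
    · have : m (fun _ => n) = 0 := by ext i; simp [m]
      rw [this, Real.fourier_eq']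
      simp only [inner_zero_right, mul_zero, Complex.ofReal_zero, zero_mul, Complex.exp_zero, one_smul]
      rw [integral_complex_ofReal]
      simp [div_pow]
    · intro k _ hk
      obtain ⟨i, hi'⟩ := Function.ne_iff.1 hk
      rw [fourier_vanish14 F hi hF (m k) i, mul_zero]
      have h0 : ((n : ℤ) - k i) ≠ 0 := by omega
      have := Int.one_le_abs h0
      simp only [m]
      exact_mod_cast this
    · intro h
      refine absurd ?_ h
      simp [Fintype.mem_piFinset]; omega
  exact_mod_cast key

lemma lower14 {N : ℕ} (F : EuclideanSpace ℝ (Fin N) → ℝ) (hc : Continuous F) (h0 : ∀ x, 0 ≤ F x)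
    (hi : Integrable F)
    (hF : ∀ ξ ∉ {x : EuclideanSpace ℝ (Fin N) | ∀ i, |x i| ≤ 1}, 𝓕 (fun x => (F x : ℂ)) ξ = 0) :
    F 0 ≤ ∫ x, F x := by
  have hcc : Continuous (fun x : EuclideanSpace ℝ (Fin N) => ∏ i, cos (π * x i) ^ 2) := by fun_prop
  have hcn : ∀ x : EuclideanSpace ℝ (Fin N), 0 ≤ ∏ i, cos (π * x i) ^ 2 :=
    fun x => Finset.prod_nonneg fun i _ => sq_nonneg _
  have hle : ∀ x : EuclideanSpace ℝ (Fin N), ∏ i, cos (π * x i) ^ 2 ≤ 1 :=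
    fun x => Finset.prod_le_one (fun i _ => sq_nonneg _) fun i _ => cos_sq_le_one _
  have ht := tendsto_setIntegral_pow_smul_of_unique_maximum_of_isCompact_of_continuousOn
    (μ := (volume : Measure (EuclideanSpace ℝ (Fin N))))
    (cube_compact14 (N := N) (1/2)) hcc.continuousOn (x₀ := 0) (g := F) ?_ (fun x _ => hcn x) (by simp)
    ?_ hc.continuousOn
  · refine le_of_tendsto ht (Filter.Eventually.of_forall fun n => ?_)
    rw [cube_int14]
    have hb : (0:ℝ) < ((2 * n).choose n / 4 ^ n : ℝ) ^ N := by
      have : 0 < (2 * n).choose n := Nat.choose_pos (by omega)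
      positivity
    rw [smul_eq_mul, inv_mul_le_iff₀ hb, ← full_int14 F hi hF]
    refine setIntegral_le_integral ?_ (Filter.Eventually.of_forall fun x =>
      mul_nonneg (pow_nonneg (hcn x) n) (h0 x))
    refine hi.mono' ((hcc.pow n).mul hc).aestronglyMeasurable (Filter.Eventually.of_forall fun x => ?_)
    rw [smul_eq_mul, Real.norm_eq_abs, abs_of_nonneg (mul_nonneg (pow_nonneg (hcn x) n) (h0 x))]
    exact mul_le_of_le_one_left (h0 x) (pow_le_one₀ (hcn x) (hle x))
  · intro y hy hy0
    have : ∃ i, y i ≠ 0 := by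
      by_contra h; push Not at h
      exact hy0 (by ext i; simpa using h i)
    obtain ⟨i, hi'⟩ := this
    have h1 : ∏ i, cos (π * (0 : EuclideanSpace ℝ (Fin N)) i) ^ 2 = 1 := by simp
    rw [h1, ← Finset.mul_prod_erase _ _ (Finset.mem_univ i)]
    have h2 : ∏ j ∈ Finset.univ.erase i, cos (π * y j) ^ 2 ≤ 1 :=
      Finset.prod_le_one (fun i _ => sq_nonneg _) fun i _ => cos_sq_le_one _
    refine (mul_le_of_le_one_right (sq_nonneg _) h2).trans_lt ?_
    have hs : sin (π * y i) ≠ 0 := by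
      intro hs
      rw [sin_eq_zero_iff] at hs
      obtain ⟨k, hk⟩ := hs
      have hk' : (k : ℝ) = y i := by
        have := pi_ne_zero
        apply mul_left_cancel₀ this; linarith
      have h3 := hy i
      rw [← hk'] at h3 hi'
      have h4 : 1 ≤ |k| := Int.one_le_abs (by rintro rfl; simp at hi')
      have h5 : (1:ℝ) ≤ |(k:ℝ)| := by exact_mod_cast h4
      linarith
    rw [cos_sq']
    have := sq_pos_of_ne_zero hs
    linarith
  · apply subset_closure
    rw [mem_interior_iff_mem_nhds]
    have : {x : EuclideanSpace ℝ (Fin N) | ∀ i, |x i| ≤ 1/2} = ⋂ i, {x | |x i| ≤ 1/2} := by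
      ext; simp
    rw [this, Filter.iInter_mem]
    intro i
    have hco : Continuous (fun x : EuclideanSpace ℝ (Fin N) => |x i|) := by fun_prop
    exact Filter.mem_of_superset (hco.continuousAt.preimage_mem_nhds
      (gt_mem_nhds (show |(0 : EuclideanSpace ℝ (Fin N)) i| < 1/2 by simp))) (fun x hx => show |x i| ≤ 1/2 from le_of_lt (show |x i| < 1/2 from hx))

/-- For the cube `Q = [-1,1]^N`: every nonzero continuous integrable `F ≥ 0`
with `F(0) ≥ 1` and Fourier transform vanishing outside `Q` has `∫ F ≥ 1`; the product of
squared sinc functions is admissible with integral exactly `1`; hence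
`η(Q) = 1 = 2^N / vol(Q)`. -/
theorem stmt_14 {N : ℕ} (hN : 0 < N)
    (Q : Set (EuclideanSpace ℝ (Fin N)))
    (hQ : Q = {x : EuclideanSpace ℝ (Fin N) | ∀ i, |x i| ≤ 1})
    (F₀ : EuclideanSpace ℝ (Fin N) → ℝ)
    (hF₀ : F₀ = fun x => ∏ n : Fin N,
      (if x n = 0 then 1 else (Real.sin (Real.pi * x n) / (Real.pi * x n)) ^ 2)) :
    (∀ F : EuclideanSpace ℝ (Fin N) → ℝ,
        Continuous F → (∀ x, 0 ≤ F x) → 1 ≤ F 0 → F ≠ 0 → Integrable F volume →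
        (∀ ξ ∉ Q, 𝓕 (fun x => (F x : ℂ)) ξ = 0) → 1 ≤ ∫ x, F x) ∧
    (Continuous F₀ ∧ (∀ x, 0 ≤ F₀ x) ∧ 1 ≤ F₀ 0 ∧ F₀ ≠ 0 ∧ Integrable F₀ volume ∧
      (∀ ξ ∉ Q, 𝓕 (fun x => (F₀ x : ℂ)) ξ = 0) ∧ (∫ x, F₀ x) = 1) ∧
    sInf {t : ℝ | ∃ F : EuclideanSpace ℝ (Fin N) → ℝ,
        Continuous F ∧ (∀ x, 0 ≤ F x) ∧ 1 ≤ F 0 ∧ F ≠ 0 ∧ Integrable F volume ∧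
        (∀ ξ ∉ Q, 𝓕 (fun x => (F x : ℂ)) ξ = 0) ∧ t = ∫ x, F x}
      = 2 ^ N / (volume Q).toReal ∧
    (2 : ℝ) ^ N / (volume Q).toReal = 1 := by
  subst hQ
  have hF : F₀ = fun x => ∏ n : Fin N, sinc (π * x n) ^ 2 := by
    rw [hF₀]; ext x
    refine Finset.prod_congr rfl fun i _ => ?_
    by_cases h : x i = 0
    · simp [h]
    · rw [if_neg h, sinc_of_ne_zero (by simp [h, pi_ne_zero])]
  clear hF₀
  have hlow : ∀ F : EuclideanSpace ℝ (Fin N) → ℝ,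
        Continuous F → (∀ x, 0 ≤ F x) → 1 ≤ F 0 → F ≠ 0 → Integrable F volume →
        (∀ ξ ∉ {x : EuclideanSpace ℝ (Fin N) | ∀ i, |x i| ≤ 1}, 𝓕 (fun x => (F x : ℂ)) ξ = 0) →
        1 ≤ ∫ x, F x :=
    fun F hc h0 h1 _ hi hF => h1.trans (lower14 F hc h0 hi hF)
  have hadm : Continuous F₀ ∧ (∀ x, 0 ≤ F₀ x) ∧ 1 ≤ F₀ 0 ∧ F₀ ≠ 0 ∧ Integrable F₀ volume ∧
      (∀ ξ ∉ {x : EuclideanSpace ℝ (Fin N) | ∀ i, |x i| ≤ 1}, 𝓕 (fun x => (F₀ x : ℂ)) ξ = 0) ∧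
      (∫ x, F₀ x) = 1 := by
    have h1 : F₀ 0 = 1 := by simp [hF]
    have hft : ∀ t : ℝ, 𝓕 (fun x : ℝ => ((sinc (π * x) ^ 2 : ℝ) : ℂ)) t = (tri14 t : ℂ) :=
      sinc14_fourier
    refine ⟨?_, ?_, h1.ge, ?_, ?_, ?_, ?_⟩
    · rw [hF]
      have := continuous_sinc
      fun_prop
    · intro x; rw [hF]; exact Finset.prod_nonneg fun i _ => sq_nonneg _
    · intro h; rw [h] at h1; simp at h1
    · rw [hF]; exact integrable_prod14 (fun _ t => sinc (π * t) ^ 2) fun _ => sinc14_int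
    · intro ξ hξ
      rw [hF, fourier_prod14 (fun t => sinc (π * t) ^ 2)]
      simp only [Set.mem_ofPred_eq, not_forall, not_le] at hξ
      obtain ⟨i, hi⟩ := hξ
      refine Finset.prod_eq_zero (Finset.mem_univ i) ?_
      rw [hft, tri14_zero hi.le, Complex.ofReal_zero]
    · rw [hF, int_prod14 (fun _ t => sinc (π * t) ^ 2)]
      have h0 := hft 0
      rw [Real.fourier_real_eq_integral_exp_smul] at h0
      simp only [mul_zero, Complex.ofReal_zero, zero_mul, Complex.exp_zero, one_smul] at h0
      rw [integral_complex_ofReal] at h0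
      have h2 : ∫ x : ℝ, sinc (π * x) ^ 2 = tri14 0 := by exact_mod_cast h0
      rw [h2]; simp [tri14]
  have hvol : (2 : ℝ) ^ N / (volume {x : EuclideanSpace ℝ (Fin N) | ∀ i, |x i| ≤ 1}).toReal = 1 := by
    rw [cube_vol14 1 zero_le_one]; simp
  refine ⟨hlow, hadm, ?_, hvol⟩
  rw [hvol]
  refine IsLeast.csInf_eq ⟨?_, ?_⟩
  · obtain ⟨a, b, c, d, e, f, g⟩ := hadm
    exact ⟨F₀, a, b, c, d, e, f, g.symm⟩
  · rintro t ⟨F, a, b, c, d, e, f, rfl⟩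
    exact hlow F a b c d e f
end

section
/- Let B be the Euclidean unit ball in R^N. Then η(B) = 2^N / vol_N(B), where η(B) is the infimum of ∫_{R^N} F dx over nonzero continuous F ≥ 0 with F(0) ≥ 1 and Fourier transform supported in B. -/
open MeasureTheory Real Metric
open scoped FourierTransform


open Polynomial in
lemma muntz_aux (s : ℝ) (hs : 0 < s) (h : ℝ[X]) :
    ∫ y in (0:ℝ)..1, (h.eval y * (2 * (y * h.derivative.eval y) + s * h.eval y)) * y ^ (s - 1)
      = h.eval 1 ^ 2 := by
  have hint : IntervalIntegrable (fun y : ℝ => (h.eval y * (2 * (y * h.derivative.eval y) + s * h.eval y)) * y ^ (s - 1)) volume 0 1 := by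
    apply IntervalIntegrable.continuousOn_mul
    · exact intervalIntegral.intervalIntegrable_rpow' (by linarith)
    · fun_prop
  have := intervalIntegral.integral_eq_sub_of_hasDerivAt_of_le (a := 0) (b := 1)
    (f := fun y : ℝ => h.eval y ^ 2 * y ^ s) zero_le_one ?_ ?_ hint
  · rw [this]; simp [Real.zero_rpow hs.ne']
  · apply ContinuousOn.mul (by fun_prop)
    exact (Real.continuous_rpow_const hs.le).continuousOn
  · intro y hy
    have h1 := ((h.hasDerivAt y).pow 2).mul (Real.hasDerivAt_rpow_const (p := s) (Or.inl hy.1.ne'))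
    refine HasDerivAt.congr_deriv (f := fun y : ℝ => h.eval y ^ 2 * y ^ s) h1 ?_
    have : y ^ s = y * y ^ (s - 1) := by
      rw [Real.rpow_sub hy.1, Real.rpow_one]; field_simp [hy.1.ne']
    rw [this]
    simp
    ring

open Polynomial in
lemma poly_int (s : ℝ) (hs : 0 < s) (q : ℝ[X]) :
    IntervalIntegrable (fun y : ℝ => q.eval y * y ^ (s - 1)) volume 0 1 := by
  apply IntervalIntegrable.continuousOn_mul
  · exact intervalIntegral.intervalIntegrable_rpow' (by linarith)
  · fun_prop

open Polynomial in
lemma muntz (s : ℝ) (hs : 0 < s) (m : ℕ) : ∀ q : ℝ[X], q.natDegree ≤ m →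
    q.eval 0 ^ 2 * ((1 / s) * ∏ k ∈ Finset.range m, (((k:ℝ) + 1) / (k + 1 + s)) ^ 2)
      ≤ ∫ y in (0:ℝ)..1, (q.eval y) ^ 2 * y ^ (s - 1) := by
  induction m with
  | zero =>
    intro q hq
    obtain ⟨c, rfl⟩ : ∃ c, q = C c := ⟨_, Polynomial.eq_C_of_natDegree_le_zero hq⟩
    simp only [eval_C, intervalIntegral.integral_const_mul]
    rw [integral_rpow (Or.inl (by linarith))]
    simp [Real.zero_rpow hs.ne']
  | succ m ih =>
    intro q hq
    set n : ℝ := (m : ℝ) + 1 with hn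
    have hn0 : 0 < n := by positivity
    set h : ℝ[X] := ∑ k ∈ Finset.range (m + 2), monomial k (q.coeff k / (k + n + s)) with hh
    have hc : ∀ k, h.coeff k = q.coeff k / (k + n + s) := by
      intro k
      simp only [hh, finsetSum_coeff, coeff_monomial]
      rw [Finset.sum_ite_eq']
      split_ifs with hk
      · rfl
      · rw [Polynomial.coeff_eq_zero_of_natDegree_lt]; · simp
        simp at hk; omega
    have hXd : ∀ k, (X * derivative h).coeff k = k * h.coeff k := by
      intro k
      cases k with
      | zero => simp
      | succ k => rw [coeff_X_mul, coeff_derivative]; push_cast; ring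
    set g : ℝ[X] := X * derivative h - C n * h with hg
    have hqq : q = X * derivative h + C (n + s) * h := by
      ext k
      rw [coeff_add, hXd, coeff_C_mul, hc]
      have : (k:ℝ) + n + s ≠ 0 := by positivity
      field_simp; ring
    have hgd : g.natDegree ≤ m := by
      rw [natDegree_le_iff_coeff_eq_zero]
      intro k hk
      rw [hg, coeff_sub, hXd, coeff_C_mul, hc]
      rcases (show m + 1 ≤ k from hk).eq_or_lt with h1 | h1
      · subst h1; push_cast; ring
      · rw [Polynomial.coeff_eq_zero_of_natDegree_lt (show q.natDegree < k by omega)]; simp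
    have hg0 : g.eval 0 ^ 2 = q.eval 0 ^ 2 * (n / (n + s)) ^ 2 := by
      have : q.eval 0 = (n + s) * h.eval 0 := by
        conv_lhs => rw [hqq]
        simp
      rw [this]; simp [hg]; field_simp
    have hi := ih g hgd
    have hdiff := muntz_aux s hs h
    have e1 : ∫ y in (0:ℝ)..1, (q.eval y) ^ 2 * y ^ (s - 1) =
       (∫ y in (0:ℝ)..1, (g.eval y) ^ 2 * y ^ (s - 1)) + (2 * n + s) * h.eval 1 ^ 2 := by
      rw [← hdiff, ← intervalIntegral.integral_const_mul, ← intervalIntegral.integral_add]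
      · congr 1; ext y
        have : q.eval y = y * (derivative h).eval y + (n + s) * h.eval y := by
          conv_lhs => rw [hqq]
          simp
        rw [this]; simp [hg]; ring
      · convert poly_int s hs (g ^ 2) using 2
        simp
      · apply IntervalIntegrable.const_mul
        convert poly_int s hs (h * (2 * (X * derivative h) + C s * h)) using 2
        simp
    rw [e1, Finset.prod_range_succ]
    have : 0 ≤ (2 * n + s) * h.eval 1 ^ 2 := by positivity
    rw [hg0] at hi
    rw [← hn]
    calc _ = q.eval 0 ^ 2 * (n / (n + s)) ^ 2 * ((1 / s) * ∏ k ∈ Finset.range m, (((k:ℝ) + 1) / (k + 1 + s)) ^ 2) := by ring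
      _ ≤ _ := by linarith

lemma quad_lin (A B C : ℝ) (h : ∀ y ∈ Set.Icc (0:ℝ) 1, 0 ≤ A + B * y + C * y ^ 2) :
    ∃ a e : ℝ, a ^ 2 = A ∧ ∀ y ∈ Set.Icc (0:ℝ) 1, (a + e * y) ^ 2 ≤ A + B * y + C * y ^ 2 := by
  have hA : 0 ≤ A := by simpa using h 0 (by simp)
  have h1 : 0 ≤ A + B + C := by simpa using h 1 (by simp)
  rcases hA.eq_or_lt with rfl | hA
  · exact ⟨0, 0, by simp, by simpa using h⟩
  obtain ⟨a, ha, rfl⟩ : ∃ a : ℝ, 0 < a ∧ a ^ 2 = A := ⟨√A, by positivity, Real.sq_sqrt hA.le⟩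
  obtain ⟨b, hb, hb2⟩ : ∃ b : ℝ, 0 ≤ b ∧ b ^ 2 = a ^ 2 + B + C := ⟨√_, by positivity, Real.sq_sqrt h1⟩
  suffices ∃ e, 2 * a * e ≤ B ∧ (a + e) ^ 2 ≤ a ^ 2 + B + C by
    obtain ⟨e, he1, he2⟩ := this
    refine ⟨a, e, rfl, fun y hy => ?_⟩
    nlinarith [mul_nonneg (mul_nonneg hy.1 (sub_nonneg.2 hy.2)) (sub_nonneg.2 he1), mul_nonneg (mul_nonneg hy.1 hy.1) (sub_nonneg.2 he2)]
  by_cases hc : 2 * a * (b - a) ≤ B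
  · exact ⟨b - a, hc, by rw [← hb2]; simp⟩
  push Not at hc
  refine ⟨B / (2 * a), by field_simp; rfl, ?_⟩
  obtain ⟨e, he⟩ : ∃ e, e = B / (2 * a) := ⟨_, rfl⟩
  have hB : B = 2 * a * e := by rw [he]; field_simp
  rw [← he]
  subst hB
  have heb : e < b - a := by nlinarith
  by_cases h0 : 0 ≤ a + e
  · rw [← hb2]; nlinarith
  · push Not at h0
    have he0 : e < 0 := by linarith
    have := h (-a / e) ⟨by apply div_nonneg_of_nonpos <;> linarith, by rw [div_le_one_of_neg he0]; linarith⟩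
    have h2 : 0 ≤ C - e ^ 2 := by
      have h3 : a ^ 2 + 2 * a * e * (-a / e) + C * (-a / e) ^ 2 = (C - e ^ 2) * (a ^ 2 / e ^ 2) := by
        have := he0.ne
        field_simp; ring
      rw [h3] at this
      exact nonneg_of_mul_nonneg_left this (by have := he0.ne; positivity)
    nlinarith


open Polynomial in
lemma poly_quad (a : ℝ[X]) (hd : a.natDegree ≤ 2) (h : ∀ y ∈ Set.Icc (0:ℝ) 1, 0 ≤ a.eval y) :
    ∃ l : ℝ[X], l.natDegree ≤ 1 ∧ l.eval 0 ^ 2 = a.eval 0 ∧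
      ∀ y ∈ Set.Icc (0:ℝ) 1, l.eval y ^ 2 ≤ a.eval y := by
  have he : ∀ y, a.eval y = a.coeff 0 + a.coeff 1 * y + a.coeff 2 * y ^ 2 := by
    intro y
    rw [Polynomial.eval_eq_sum_range' (n := 3) (by omega)]
    simp [Finset.sum_range_succ]
  obtain ⟨c, e, h1, h2⟩ := quad_lin _ _ _ (fun y hy => (he y) ▸ h y hy)
  refine ⟨C c + C e * X, ?_, ?_, ?_⟩
  · compute_degree
  · simp [h1, he]
  · intro y hy; rw [he]; simpa using h2 y hy

open Polynomial in
lemma exists_deg2_factor (p : ℝ[X]) (hp : 2 ≤ p.natDegree) :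
    ∃ a b : ℝ[X], p = a * b ∧ a.natDegree = 2 := by
  have hp0 : p ≠ 0 := by rintro rfl; simp at hp
  have key : ∀ r : ℝ[X], 1 ≤ r.natDegree → ∃ a b : ℝ[X], r = a * b ∧ (a.natDegree = 1 ∨ a.natDegree = 2) := by
    intro r hr
    have hu : ¬ IsUnit r := fun h => by
      have := natDegree_eq_zero_of_isUnit h; omega
    obtain ⟨a, ha, b, hb⟩ := WfDvdMonoid.exists_irreducible_factor hu (by rintro rfl; simp at hr)
    refine ⟨a, b, hb, ?_⟩
    have h2 : a.natDegree ≤ 2 := natDegree_le_of_degree_le ha.degree_le_two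
    have h1 := ha.natDegree_pos
    omega
  obtain ⟨a, b, hab, h | h⟩ := key p (by omega)
  · have hb : p.natDegree = a.natDegree + b.natDegree := by
      rw [hab, natDegree_mul (by rintro rfl; simp at hab; exact hp0 hab) (by rintro rfl; simp at hab; exact hp0 hab)]
    obtain ⟨c, d, hcd, h' | h'⟩ := key b (by omega)
    · refine ⟨a * c, d, by rw [hab, hcd, mul_assoc], ?_⟩
      rw [natDegree_mul (by rintro rfl; simp at h) (by rintro rfl; simp at h'), h, h']
    · exact ⟨c, a * d, by rw [hab, hcd]; ring, h'⟩
  · exact ⟨a, b, hab, h⟩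

/-- Nonnegativity extends from a dense subset. -/
lemma nonneg_Icc_of_Ioo_diff (f : ℝ → ℝ) (hf : Continuous f) (c : ℝ)
    (h : ∀ y ∈ Set.Ioo (0:ℝ) 1, y ≠ c → 0 ≤ f y) : ∀ y ∈ Set.Icc (0:ℝ) 1, 0 ≤ f y := by
  have h1 : ∀ y ∈ Set.Ioo (0:ℝ) 1, 0 ≤ f y := by
    have : ∀ y ∈ Set.Ioo (0:ℝ) 1, y ∈ closure (Set.Ioo (0:ℝ) 1 ∩ {c}ᶜ) := by
      intro y hy
      exact (dense_compl_singleton c).open_subset_closure_inter isOpen_Ioo hy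
    intro y hy
    exact closure_minimal (s := Set.Ioo (0:ℝ) 1 ∩ {c}ᶜ) (t := {y | 0 ≤ f y}) (fun z hz => h z hz.1 hz.2)
      (isClosed_le continuous_const hf) (this y hy)
  intro y hy
  rw [← closure_Ioo (by norm_num)] at hy
  exact closure_minimal (t := {y | 0 ≤ f y}) h1 (isClosed_le continuous_const hf) hy

open Polynomial in
lemma factor_nonneg (p : ℝ[X]) (hp : 2 ≤ p.natDegree) (h : ∀ y ∈ Set.Icc (0:ℝ) 1, 0 ≤ p.eval y) :
    ∃ a b : ℝ[X], p = a * b ∧ a.natDegree = 2 ∧ (∀ y ∈ Set.Icc (0:ℝ) 1, 0 ≤ a.eval y) ∧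
      (∀ y ∈ Set.Icc (0:ℝ) 1, 0 ≤ b.eval y) := by
  by_cases hr : ∃ c ∈ Set.Ioo (0:ℝ) 1, p.eval c = 0
  · obtain ⟨c, hc, h0⟩ := hr
    obtain ⟨r, hr⟩ := dvd_iff_isRoot.2 h0
    have hrc : r.eval c = 0 := by
      have hl : ∀ y ∈ Set.Ioo (0:ℝ) 1, 0 ≤ (y - c) * r.eval y := by
        intro y hy
        have := h y ⟨hy.1.le, hy.2.le⟩
        rw [hr] at this; simpa using this
      have hcont : ContinuousAt (fun y => r.eval y) c := by fun_prop
      apply le_antisymm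
      · refine le_of_tendsto (hcont.tendsto.mono_left (nhdsWithin_le_nhds (s := Set.Iio c))) ?_
        filter_upwards [Ioo_mem_nhdsLT hc.1] with y hy
        have := hl y ⟨hy.1, hy.2.trans hc.2⟩
        nlinarith [hy.2]
      · refine ge_of_tendsto (hcont.tendsto.mono_left (nhdsWithin_le_nhds (s := Set.Ioi c))) ?_
        filter_upwards [Ioo_mem_nhdsGT hc.2] with y hy
        have := hl y ⟨hc.1.trans hy.1, hy.2⟩
        nlinarith [hy.1]
    obtain ⟨b, hb⟩ := dvd_iff_isRoot.2 hrc
    refine ⟨(X - C c) ^ 2, b, by rw [hr, hb]; ring, by simp, ?_, ?_⟩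
    · intro y hy; simp; positivity
    · apply nonneg_Icc_of_Ioo_diff _ (by fun_prop) c
      intro y hy hyc
      have := h y ⟨hy.1.le, hy.2.le⟩
      rw [hr, hb] at this
      simp at this
      have h2 : 0 < (y - c) ^ 2 := by have := sub_ne_zero.2 hyc; positivity
      rw [← mul_assoc, ← sq] at this
      exact nonneg_of_mul_nonneg_right this h2
  · push Not at hr
    obtain ⟨a, b, hab, ha⟩ := exists_deg2_factor p hp
    have hne : ∀ y ∈ Set.Ioo (0:ℝ) 1, a.eval y ≠ 0 := by
      intro y hy h0; apply hr y hy; rw [hab]; simp [h0]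
    have hsgn : (∀ y ∈ Set.Ioo (0:ℝ) 1, 0 < a.eval y) ∨ (∀ y ∈ Set.Ioo (0:ℝ) 1, a.eval y < 0) := by
      by_contra hcon
      push Not at hcon
      obtain ⟨⟨y, hy, hy1⟩, ⟨z, hz, hz1⟩⟩ := hcon
      have := (isPreconnected_Ioo (a := (0:ℝ)) (b := 1)).intermediate_value hy hz
        (f := fun y => a.eval y) (by fun_prop)
      obtain ⟨w, hw, hw0⟩ := this ⟨hy1, hz1⟩
      exact hne w hw hw0
    have hnn : ∀ y ∈ Set.Ioo (0:ℝ) 1, 0 ≤ a.eval y * b.eval y := by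
      intro y hy
      have := h y ⟨hy.1.le, hy.2.le⟩
      rw [hab] at this; simpa using this
    rcases hsgn with hs | hs
    · refine ⟨a, b, hab, ha, ?_, ?_⟩
      · exact nonneg_Icc_of_Ioo_diff _ (by fun_prop) 0 (fun y hy _ => (hs y hy).le)
      · exact nonneg_Icc_of_Ioo_diff _ (by fun_prop) 0 (fun y hy _ => nonneg_of_mul_nonneg_right (hnn y hy) (hs y hy))
    · refine ⟨-a, -b, by rw [hab]; ring, by simpa using ha, ?_, ?_⟩
      · refine nonneg_Icc_of_Ioo_diff _ (by fun_prop) 0 (fun y hy _ => ?_)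
        simpa using (hs y hy).le
      · refine nonneg_Icc_of_Ioo_diff _ (by fun_prop) 0 (fun y hy _ => ?_)
        have h1 := hs y hy
        have h2 := hnn y hy
        simp
        nlinarith

open Polynomial in
lemma poly_sq_minorant (m : ℕ) : ∀ p : ℝ[X], p.natDegree ≤ 2 * m →
    (∀ y ∈ Set.Icc (0:ℝ) 1, 0 ≤ p.eval y) →
    ∃ q : ℝ[X], q.natDegree ≤ m ∧ q.eval 0 ^ 2 = p.eval 0 ∧
      ∀ y ∈ Set.Icc (0:ℝ) 1, q.eval y ^ 2 ≤ p.eval y := by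
  induction m with
  | zero =>
    intro p hp h
    obtain ⟨c, rfl⟩ : ∃ c, p = C c := ⟨_, Polynomial.eq_C_of_natDegree_le_zero (by simpa using hp)⟩
    have hc : 0 ≤ c := by simpa using h 0 (by simp)
    exact ⟨C (√c), by simp, by simp [hc], by simp [hc]⟩
  | succ m ih =>
    intro p hp h
    by_cases h2 : 2 ≤ p.natDegree
    · obtain ⟨a, b, hab, ha, ha0, hb0⟩ := factor_nonneg p h2 h
      have hbd : b.natDegree ≤ 2 * m := by
        by_cases hb : b = 0
        · simp [hb]
        · have := natDegree_mul (p := a) (q := b) (by rintro rfl; simp at ha) hb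
          rw [← hab] at this; omega
      obtain ⟨l, hl, hl0, hl1⟩ := poly_quad a ha.le ha0
      obtain ⟨q, hq, hq0, hq1⟩ := ih b hbd hb0
      refine ⟨l * q, natDegree_mul_le.trans (by omega), ?_, ?_⟩
      · rw [hab]; simp [mul_pow, hl0, hq0]
      · intro y hy
        rw [hab]; simp only [eval_mul, mul_pow]
        exact mul_le_mul (hl1 y hy) (hq1 y hy) (by positivity) (ha0 y hy)
    · obtain ⟨l, hl, hl0, hl1⟩ := poly_quad p (by omega) h
      exact ⟨l, by omega, hl0, hl1⟩

open Polynomial in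
lemma poly_main (s : ℝ) (hs : 0 < s) (m : ℕ) (p : ℝ[X]) (hp : p.natDegree ≤ 2 * m)
    (h : ∀ y ∈ Set.Icc (0:ℝ) 1, 0 ≤ p.eval y) :
    p.eval 0 * ((1 / s) * ∏ k ∈ Finset.range m, (((k:ℝ) + 1) / (k + 1 + s)) ^ 2)
      ≤ ∫ y in (0:ℝ)..1, p.eval y * y ^ (s - 1) := by
  obtain ⟨q, hq, hq0, hq1⟩ := poly_sq_minorant m p hp h
  rw [← hq0]
  refine (muntz s hs m q hq).trans ?_
  apply intervalIntegral.integral_mono_on zero_le_one _ (poly_int s hs p)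
  · intro y hy
    exact mul_le_mul_of_nonneg_right (hq1 y hy) (Real.rpow_nonneg hy.1 _)
  · convert poly_int s hs (q ^ 2) using 2
    simp


lemma decay_isBigO (h : ℝ → ℂ) (M : ℝ) (hM : ∀ x, ‖h x‖ * (1 + x ^ 2) ≤ M) :
    h =O[Filter.cocompact ℝ] (fun x : ℝ => |x| ^ (-2 : ℝ)) := by
  refine Asymptotics.IsBigO.of_bound M ?_
  have : ∀ᶠ x : ℝ in Filter.cocompact ℝ, x ∈ ({0}ᶜ : Set ℝ) :=
    (isCompact_singleton (x := (0:ℝ))).compl_mem_cocompact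
  filter_upwards [this] with x hx
  have hx0 : x ≠ 0 := hx
  have h1 : |x| ^ (-2:ℝ) = (x ^ 2)⁻¹ := by
    rw [Real.rpow_neg (abs_nonneg _)]
    norm_cast
    rw [sq_abs]
  have h3 : 0 < x ^ 2 := by positivity
  rw [h1, norm_of_nonneg (by positivity), ← div_eq_mul_inv, le_div_iff₀ h3]
  have := hM x
  nlinarith [norm_nonneg (h x)]

lemma decay_summable (h : ℝ → ℂ) (M : ℝ) (hM : ∀ x, ‖h x‖ * (1 + x ^ 2) ≤ M) (x : ℝ) :
    Summable (fun n : ℤ => h (x + n)) := by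
  have hM' : ∀ y, ‖h (x + y)‖ * (1 + y ^ 2) ≤ M * (2 * (1 + x ^ 2)) := by
    intro y
    have h1 : 1 + y ^ 2 ≤ (1 + (x + y) ^ 2) * (2 * (1 + x ^ 2)) := by
      nlinarith [sq_nonneg (x + y), sq_nonneg x, sq_nonneg (2 * x + y), mul_nonneg (sq_nonneg (x+y)) (sq_nonneg x)]
    calc _ ≤ ‖h (x + y)‖ * ((1 + (x + y) ^ 2) * (2 * (1 + x ^ 2))) := by gcongr
      _ = (‖h (x + y)‖ * (1 + (x + y) ^ 2)) * (2 * (1 + x ^ 2)) := by ring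
      _ ≤ _ := by gcongr; exact hM _
  have := (decay_isBigO (fun y => h (x + y)) _ hM').comp_tendsto Int.tendsto_coe_cofinite
  exact summable_of_isBigO (Real.summable_abs_int_rpow (b := 2) (by norm_num)) this

lemma lintegral_unfold (K : ℝ → ENNReal) (hK : Measurable K) :
    ∫⁻ x in Set.Ioc (-(1/2):ℝ) (1/2), ∑' n : ℤ, K (x + n) = ∫⁻ x, K x := by
  rw [lintegral_tsum (f := fun (n : ℤ) x => K (x + n)) (fun n => (hK.comp (measurable_add_const (n:ℝ))).aemeasurable)]
  have hd : Pairwise (Function.onFun Disjoint (fun n : ℤ => Set.Ioc (-(1/2) + (n:ℝ)) (-(1/2) + n + 1))) := by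
    exact Set.pairwise_disjoint_Ioc_add_intCast (-(1/2) : ℝ)
  rw [← setLIntegral_univ, ← iUnion_Ioc_add_intCast (-(1/2) : ℝ), lintegral_iUnion (fun _ => measurableSet_Ioc) hd]
  congr 1; ext n
  rw [← (measurePreserving_add_right volume (n:ℝ)).setLIntegral_comp_preimage measurableSet_Ioc hK]
  congr 3
  ext x; simp only [Set.mem_preimage, Set.mem_Ioc]
  constructor <;> rintro ⟨a, b⟩ <;> constructor <;> linarith

open Polynomial in
lemma periodize_poly (m : ℕ) (h : ℝ → ℝ) (hc : Continuous h) (h0 : ∀ x, 0 ≤ h x)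
    (M : ℝ) (hM : ∀ x, h x * (1 + x ^ 2) ≤ M)
    (hF : ∀ j : ℤ, 2 * (m:ℤ) < |j| → 𝓕 (fun x => (h x : ℂ)) (j : ℝ) = 0) :
    ∃ p : ℝ[X], p.natDegree ≤ 2 * m ∧
      (∀ x : ℝ, p.eval (sin (π * x) ^ 2) = ((∑' n : ℤ, h (x + n)) + ∑' n : ℤ, h (-x + n)) / 2) := by
  set c : ℤ → ℂ := fun j => 𝓕 (fun x => (h x : ℂ)) (j : ℝ) with hcdef
  set S : Finset ℤ := Finset.Icc (-(2 * (m:ℤ))) (2 * m) with hS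
  have hcS : ∀ j ∉ S, c j = 0 := by
    intro j hj
    apply hF
    simp only [hS, Finset.mem_Icc, ← abs_le, not_le] at hj
    exact hj
  have hP : ∀ x : ℝ, ((∑' n : ℤ, h (x + n) : ℝ) : ℂ) = ∑ j ∈ S, c j * Complex.exp (2 * π * Complex.I * j * x) := by
    intro x
    have hsum : Summable (fun n : ℤ => c n) := summable_of_ne_finset_zero (s := S) hcS
    have := Real.tsum_eq_tsum_fourier_of_rpow_decay_of_summable (f := fun x => (h x : ℂ)) (by fun_prop)
      (b := 2) (by norm_num) (decay_isBigO _ M (by intro x; simpa [abs_of_nonneg (h0 x)] using hM x)) hsum x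
    push_cast
    rw [this, tsum_eq_sum (s := S)]
    · apply Finset.sum_congr rfl
      intro j _
      rw [fourier_coe_apply]; simp [hcdef]
    · intro j hj
      have := hcS j hj
      simp only [hcdef] at this
      rw [this, zero_mul]
  refine ⟨∑ j ∈ S, C (c j).re * (Chebyshev.T ℝ j).comp (1 - 2 * X), ?_, ?_⟩
  · apply natDegree_sum_le_of_forall_le
    intro j hj
    refine (natDegree_C_mul_le _ _).trans (natDegree_comp_le.trans ?_)
    rw [Chebyshev.natDegree_T]
    have h1 : (1 - 2 * X : ℝ[X]).natDegree ≤ 1 := by compute_degree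
    have h2 : j.natAbs ≤ 2 * m := by
      simp only [hS, Finset.mem_Icc] at hj; omega
    calc _ ≤ j.natAbs * 1 := Nat.mul_le_mul_left _ h1
      _ ≤ _ := by omega
  · intro x
    have hcos : 1 - 2 * sin (π * x) ^ 2 = cos (2 * π * x) := by
      rw [mul_assoc, Real.cos_two_mul, Real.cos_sq']; ring
    have h1 : ((∑' n : ℤ, h (x + n)) + ∑' n : ℤ, h (-x + n)) =
        (∑ j ∈ S, c j * Complex.exp (2 * π * Complex.I * j * x) + ∑ j ∈ S, c j * Complex.exp (2 * π * Complex.I * j * (-x : ℝ))).re := by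
      rw [← hP, ← hP, ← Complex.ofReal_add, Complex.ofReal_re]
    rw [h1, ← Finset.sum_add_distrib, Complex.re_sum, eval_finsetSum, Finset.sum_div]
    apply Finset.sum_congr rfl
    intro j _
    have h2 : c j * Complex.exp (2 * π * Complex.I * j * x) + c j * Complex.exp (2 * π * Complex.I * j * (-x : ℝ))
       = c j * (2 * cos (j * (2 * π * x)) : ℝ) := by
      push_cast
      rw [Complex.cos]
      rw [show (j:ℂ) * (2 * π * x) * Complex.I = 2 * π * Complex.I * j * x by ring,
        show -((j:ℂ) * (2 * π * x)) * Complex.I = 2 * π * Complex.I * j * (-x) by ring]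
      ring
    rw [h2, Complex.re_mul_ofReal]
    simp [eval_comp, hcos, Chebyshev.T_real_cos]
    ring

lemma trig_main (N : ℕ) (hN : 0 < N) (m : ℕ) (h : ℝ → ℝ) (hc : Continuous h) (h0 : ∀ x, 0 ≤ h x)
    (M : ℝ) (hM : ∀ x, h x * (1 + x ^ 2) ≤ M)
    (hF : ∀ j : ℤ, 2 * (m:ℤ) < |j| → 𝓕 (fun x => (h x : ℂ)) (j : ℝ) = 0) :
    ENNReal.ofReal (h 0 * ((1 / ((N:ℝ)/2)) * ∏ k ∈ Finset.range m, (((k:ℝ) + 1) / (k + 1 + (N:ℝ)/2)) ^ 2))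
     ≤ ENNReal.ofReal (π ^ N) * ∫⁻ x, ENNReal.ofReal (h x * |x| ^ (N - 1)) := by
  obtain ⟨p, hpd, hp⟩ := periodize_poly m h hc h0 M hM hF
  have hsm : ∀ x, Summable (fun n : ℤ => h (x + n)) := by
    intro x
    have := decay_summable (fun x => (h x : ℂ)) M (by intro x; simpa [abs_of_nonneg (h0 x)] using hM x) x
    exact_mod_cast this
  set P : ℝ → ℝ := fun x => ∑' n : ℤ, h (x + n) with hPdef
  have hP0 : ∀ x, 0 ≤ P x := fun x => tsum_nonneg (fun n => h0 _)
  have hs : (0:ℝ) < (N:ℝ)/2 := by positivity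
  have hpnn : ∀ y ∈ Set.Icc (0:ℝ) 1, 0 ≤ p.eval y := by
    intro y hy
    have : y = sin (π * (arcsin (√y) / π)) ^ 2 := by
      rw [mul_div_cancel₀ _ pi_ne_zero, Real.sin_arcsin (by linarith [Real.sqrt_nonneg y]) (Real.sqrt_le_one.2 hy.2), Real.sq_sqrt hy.1]
    rw [this, hp]
    exact div_nonneg (add_nonneg (hP0 _) (hP0 _)) (by norm_num)
  have hmain := poly_main _ hs m p hpd hpnn
  have hp00 : h 0 ≤ p.eval 0 := by
    have := hp 0
    simp only [mul_zero, Real.sin_zero, neg_zero] at this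
    norm_num at this
    rw [this]
    have := (hsm 0).le_tsum 0 (fun n _ => h0 _)
    simpa using this
  -- substitution
  have himg : (fun x : ℝ => sin (π * x) ^ 2) '' Set.Ioo 0 (1/2) = Set.Ioo 0 1 := by
    ext y; constructor
    · rintro ⟨x, hx, rfl⟩
      have hx1 : 0 < π * x := mul_pos pi_pos hx.1
      have hx2 : π * x < π / 2 := by nlinarith [pi_pos, hx.2]
      have h1 : 0 < sin (π * x) := Real.sin_pos_of_pos_of_lt_pi hx1 (by linarith)
      have h2 : 0 < cos (π * x) := Real.cos_pos_of_mem_Ioo ⟨by linarith, hx2⟩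
      have h3 := Real.sin_sq_add_cos_sq (π * x)
      exact ⟨by positivity, by show sin (π * x) ^ 2 < 1; nlinarith⟩
    · rintro ⟨hy0, hy1⟩
      have hsq : √y < 1 := by rw [Real.sqrt_lt' one_pos]; simpa using hy1
      have hsq0 : 0 < √y := Real.sqrt_pos.2 hy0
      refine ⟨arcsin (√y) / π, ⟨by have := Real.arcsin_pos.2 hsq0; positivity, ?_⟩, ?_⟩
      · rw [div_lt_iff₀ pi_pos]
        have := Real.arcsin_lt_pi_div_two.2 hsq; linarith
      · show sin (π * (arcsin (√y) / π)) ^ 2 = y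
        rw [mul_div_cancel₀ _ pi_ne_zero, Real.sin_arcsin (by linarith) (by linarith), Real.sq_sqrt hy0.le]
  have hinj : Set.InjOn (fun x : ℝ => sin (π * x) ^ 2) (Set.Ioo 0 (1/2)) := by
    intro x hx y hy hxy
    have hpos : ∀ x ∈ Set.Ioo (0:ℝ) (1/2), 0 < π * x ∧ π * x < π / 2 := fun x hx =>
      ⟨mul_pos pi_pos hx.1, by nlinarith [pi_pos, hx.2]⟩
    have hsp : ∀ x ∈ Set.Ioo (0:ℝ) (1/2), 0 ≤ sin (π * x) := fun x hx =>
      (Real.sin_pos_of_pos_of_lt_pi (hpos x hx).1 (by linarith [(hpos x hx).2, pi_pos])).le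
    have h1 := (pow_left_inj₀ (hsp x hx) (hsp y hy) two_ne_zero).1 hxy
    have h2 := Real.injOn_sin ⟨by linarith [(hpos x hx).1, pi_pos], (hpos x hx).2.le⟩ ⟨by linarith [(hpos y hy).1, pi_pos], (hpos y hy).2.le⟩ h1
    exact mul_left_cancel₀ pi_ne_zero h2
  set w : ℝ → ℝ := fun x => |sin (π * x)| ^ (N - 1) * |cos (π * x)| with hw
  have hwc : Continuous w := by fun_prop
  have hw0 : ∀ x, 0 ≤ w x := fun x => by positivity
  have hsub : ∫ y in (0:ℝ)..1, p.eval y * y ^ ((N:ℝ)/2 - 1) =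
      ∫ x in Set.Ioo (0:ℝ) (1/2), π * (2 * p.eval (sin (π * x) ^ 2) * w x) := by
    rw [intervalIntegral.integral_of_le zero_le_one, integral_Ioc_eq_integral_Ioo, ← himg,
      integral_image_eq_integral_abs_deriv_smul (f' := fun x => 2 * sin (π * x) * (cos (π * x) * π)) measurableSet_Ioo _ hinj]
    · apply setIntegral_congr_fun measurableSet_Ioo
      intro x hx
      have hx1 : 0 < π * x := mul_pos pi_pos hx.1
      have hx2 : π * x < π / 2 := by nlinarith [pi_pos, hx.2]
      have h1 : 0 < sin (π * x) := Real.sin_pos_of_pos_of_lt_pi hx1 (by linarith)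
      have h2 : 0 < cos (π * x) := Real.cos_pos_of_mem_Ioo ⟨by linarith, hx2⟩
      have h3 : (sin (π * x) ^ 2) ^ ((N:ℝ)/2 - 1) * sin (π * x) = sin (π * x) ^ (N - 1) := by
        rw [← Real.rpow_natCast (sin (π * x)) 2, ← Real.rpow_mul h1.le, ← Real.rpow_natCast (sin (π * x)) (N - 1)]
        nth_rw 2 [← Real.rpow_one (sin (π * x))]
        rw [← Real.rpow_add h1, Nat.cast_sub hN]
        congr 1; push_cast; ring
      simp only [hw, smul_eq_mul]
      rw [abs_of_pos h1, abs_of_pos h2, abs_of_pos (by have := pi_pos; positivity), ← h3]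
      ring
    · intro x hx
      have h1 : HasDerivAt (fun x : ℝ => π * x) π x := by simpa using (hasDerivAt_id x).const_mul π
      have := (h1.sin.pow 2).hasDerivWithinAt (s := Set.Ioo (0:ℝ) (1/2))
      refine HasDerivWithinAt.congr_deriv (f := fun x : ℝ => sin (π * x) ^ 2) this ?_
      simp
  rw [hsub] at hmain
  have hA : 0 ≤ ((1 / ((N:ℝ)/2)) * ∏ k ∈ Finset.range m, (((k:ℝ) + 1) / (k + 1 + (N:ℝ)/2)) ^ 2) := by
    have : 0 ≤ ∏ k ∈ Finset.range m, (((k:ℝ) + 1) / (k + 1 + (N:ℝ)/2)) ^ 2 :=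
      Finset.prod_nonneg (fun k _ => sq_nonneg _)
    positivity
  have hmain2 := (mul_le_mul_of_nonneg_right hp00 hA).trans hmain
  refine (ENNReal.ofReal_le_ofReal hmain2).trans ?_
  rw [integral_const_mul, ENNReal.ofReal_mul pi_pos.le, integral_eq_lintegral_of_nonneg_ae]
  rotate_left
  · refine Filter.Eventually.of_forall (fun x => ?_)
    have := hpnn (sin (π * x) ^ 2) ⟨by positivity, Real.sin_sq_le_one _⟩
    have := hw0 x
    simp only [Pi.zero_apply]; positivity
  · apply Continuous.aestronglyMeasurable; fun_prop
  set K : ℝ → ENNReal := fun x => ENNReal.ofReal (h x * w x) with hK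
  have hKm : Measurable K := by
    apply Measurable.ennreal_ofReal
    exact (hc.mul hwc).measurable
  have hwper : ∀ x (n : ℤ), w (x + n) = w x := by
    intro x n
    have e : π * (x + n) = π * x + n * π := by ring
    simp only [hw]
    rw [e, Real.sin_add_int_mul_pi, Real.cos_add_int_mul_pi, abs_mul, abs_mul]
    simp [abs_zpow]
  have hweven : ∀ x, w (-x) = w x := by intro x; simp [hw]
  have hPK : ∀ x, ENNReal.ofReal (P x * w x) = ∑' n : ℤ, K (x + n) := by
    intro x
    rw [hPdef, ← tsum_mul_right, ENNReal.ofReal_tsum_of_nonneg]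
    · simp only [hK, hwper]
    · intro n; exact mul_nonneg (h0 _) (hw0 _)
    · exact (hsm x).mul_right _
  set G : ℝ → ENNReal := fun x => ∑' n : ℤ, K (x + n) with hG
  have hGm : Measurable G := by
    apply Measurable.tsum
    intro n; exact hKm.comp (measurable_add_const _)
  have hbound : ∫⁻ x in Set.Ioo (0:ℝ) (1/2), ENNReal.ofReal (2 * p.eval (sin (π * x) ^ 2) * w x) ≤ ∫⁻ x, K x := by
    have e1 : ∀ x, ENNReal.ofReal (2 * p.eval (sin (π * x) ^ 2) * w x) = G x + G (-x) := by
      intro x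
      rw [hp, hG]
      simp only [← hPK]
      rw [← ENNReal.ofReal_add (mul_nonneg (hP0 _) (hw0 _)) (mul_nonneg (hP0 _) (hw0 _)), hweven]
      congr 1
      simp only [hPdef]; ring
    simp only [e1]
    rw [lintegral_add_left hGm]
    have e2 : ∫⁻ x in Set.Ioo (0:ℝ) (1/2), G (-x) = ∫⁻ x in Set.Ioo (-(1/2):ℝ) 0, G x := by
      rw [← (Measure.measurePreserving_neg (volume : Measure ℝ)).setLIntegral_comp_preimage measurableSet_Ioo hGm]
      simp
    rw [e2, ← lintegral_unfold K hKm, ← lintegral_union measurableSet_Ioo]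
    · apply lintegral_mono_set
      rintro x (⟨a, b⟩ | ⟨a, b⟩) <;> constructor <;> linarith
    · rw [Set.disjoint_left]; rintro x ⟨a, b⟩ ⟨c, d⟩; linarith
  calc _ ≤ ENNReal.ofReal π * ∫⁻ x in Set.Ioo (0:ℝ) (1/2), ENNReal.ofReal (2 * p.eval (sin (π * x) ^ 2) * w x) := by
        gcongr; exact ENNReal.ofReal_toReal_le
    _ ≤ ENNReal.ofReal π * ∫⁻ x, K x := by gcongr
    _ ≤ ENNReal.ofReal π * ∫⁻ x, ENNReal.ofReal (π ^ (N-1)) * ENNReal.ofReal (h x * |x| ^ (N - 1)) := by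
        gcongr with x
        rw [← ENNReal.ofReal_mul (by positivity)]
        apply ENNReal.ofReal_le_ofReal
        simp only [hw]
        have a1 : |sin (π * x)| ≤ π * |x| := by
          calc _ ≤ |π * x| := Real.abs_sin_le_abs
            _ = _ := by rw [abs_mul, abs_of_pos pi_pos]
        have a2 : |cos (π * x)| ≤ 1 := Real.abs_cos_le_one _
        calc h x * (|sin (π * x)| ^ (N - 1) * |cos (π * x)|) ≤ h x * ((π * |x|) ^ (N - 1) * 1) := by
              have := h0 x
              gcongr
          _ = _ := by rw [mul_pow]; ring
    _ = _ := by
        rw [lintegral_const_mul' _ _ ENNReal.ofReal_ne_top, ← mul_assoc, ← ENNReal.ofReal_mul pi_pos.le]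
        congr 2
        rw [← pow_succ']; congr 1; omega


lemma lintegral_scale (g : ℝ → ENNReal) (hg : Measurable g) (T : ℝ) (hT : 0 < T) :
    ∫⁻ x, g (T * x) = ENNReal.ofReal T⁻¹ * ∫⁻ x, g x := by
  rw [← lintegral_map (g := fun x => T * x) hg (measurable_const_mul T), Real.map_volume_mul_left hT.ne', lintegral_smul_measure,
    abs_of_pos (by positivity)]
  rfl

lemma gamma_asymp (s : ℝ) (hs : 0 < s) (m : ℕ) (hm : 0 < m) :
    ((1 / s) * ∏ k ∈ Finset.range m, (((k:ℝ) + 1) / (k + 1 + s)) ^ 2) * ((m:ℝ) ^ s) ^ 2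
      = s * Real.GammaSeq s m ^ 2 := by
  rw [Real.GammaSeq, Finset.prod_range_succ', ← Finset.prod_range_add_one_eq_factorial, Finset.prod_pow, Finset.prod_div_distrib]
  have h1 : ∏ k ∈ Finset.range m, (s + ((k + 1 : ℕ):ℝ)) = ∏ k ∈ Finset.range m, ((k:ℝ) + 1 + s) := by
    apply Finset.prod_congr rfl; intros; push_cast; ring
  have h2 : ∏ k ∈ Finset.range m, ((k:ℝ) + 1 + s) ≠ 0 := by
    apply Finset.prod_ne_zero_iff.2; intros; positivity
  rw [h1]
  push_cast
  field_simp
  ring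

lemma line_main (N : ℕ) (hN : 0 < N) (ρ : ℝ) (hρ : 0 < ρ) (f : ℝ → ℝ) (hc : Continuous f)
    (h0 : ∀ x, 0 ≤ f x) (M : ℝ) (hM : ∀ x, f x * (1 + x ^ 2) ≤ M)
    (hF : ∀ τ : ℝ, ρ < |τ| → 𝓕 (fun x => (f x : ℂ)) τ = 0) :
    ENNReal.ofReal (f 0 * ((2 / (π * ρ)) ^ N * ((N:ℝ)/2 * Real.Gamma ((N:ℝ)/2) ^ 2)))
     ≤ ∫⁻ x, ENNReal.ofReal (f x * |x| ^ (N - 1)) := by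
  set s : ℝ := (N:ℝ)/2 with hsdef
  have hs : 0 < s := by positivity
  have key : ∀ m : ℕ, 0 < m → ENNReal.ofReal (f 0 * ((2 / (π * ρ)) ^ N * (s * Real.GammaSeq s m ^ 2)))
     ≤ ∫⁻ x, ENNReal.ofReal (f x * |x| ^ (N - 1)) := by
    intro m hm
    set T : ℝ := 2 * m / ρ with hT
    have hT0 : 0 < T := by positivity
    have hgm : Measurable (fun x => ENNReal.ofReal (f x * |x| ^ (N - 1))) := by
      apply Measurable.ennreal_ofReal
      exact (hc.mul (by fun_prop)).measurable
    have h1 := trig_main N hN m (fun x => f (T * x)) (by fun_prop) (fun x => h0 _) (M * (1 + (T ^ 2)⁻¹)) ?_ ?_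
    · have e1 : ∀ x, ENNReal.ofReal (f (T * x) * |x| ^ (N - 1)) =
          ENNReal.ofReal (T⁻¹ ^ (N - 1)) * (fun x => ENNReal.ofReal (f x * |x| ^ (N - 1))) (T * x) := by
        intro x
        simp only
        rw [← ENNReal.ofReal_mul (by positivity), abs_mul, abs_of_pos hT0, mul_pow]
        congr 1
        rw [inv_pow]; field_simp
      simp only [e1] at h1
      rw [lintegral_const_mul' _ _ ENNReal.ofReal_ne_top, lintegral_scale _ hgm T hT0, ← mul_assoc (ENNReal.ofReal (π ^ N)),
        ← ENNReal.ofReal_mul (by positivity), ← mul_assoc (ENNReal.ofReal _), ← ENNReal.ofReal_mul (by positivity)] at h1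
      have e2 : π ^ N * T⁻¹ ^ (N - 1) * T⁻¹ = ((T / π) ^ N)⁻¹ := by
        rw [mul_assoc, ← pow_succ, Nat.sub_add_cancel hN, ← mul_pow]
        rw [← inv_pow]; congr 1; field_simp
      rw [e2] at h1
      have h2 := mul_le_mul_right h1 (ENNReal.ofReal ((T / π) ^ N))
      rw [← mul_assoc (ENNReal.ofReal _), ← ENNReal.ofReal_mul (by positivity), ← ENNReal.ofReal_mul (by positivity),
        mul_inv_cancel₀ (by positivity), ENNReal.ofReal_one, one_mul] at h2
      refine le_trans (le_of_eq ?_) h2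
      congr 1
      rw [← gamma_asymp s hs m hm]
      have e3 : ((m:ℝ) ^ s) ^ 2 = (m:ℝ) ^ N := by
        rw [← Real.rpow_natCast, ← Real.rpow_mul (by positivity), ← Real.rpow_natCast]
        congr 1; rw [hsdef]; push_cast; ring
      have e4 : (T / π) ^ N = (2 / (π * ρ)) ^ N * (m:ℝ) ^ N := by
        rw [← mul_pow]; congr 1; rw [hT]; field_simp
      rw [e3, e4, mul_zero]
      ring
    · intro x
      have a1 : 1 + x ^ 2 ≤ (1 + (T * x) ^ 2) * (1 + (T ^ 2)⁻¹) := by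
        have : (T * x) ^ 2 * (T ^ 2)⁻¹ = x ^ 2 := by field_simp
        have h3 : 0 ≤ (T ^ 2)⁻¹ := by positivity
        nlinarith [sq_nonneg (T * x)]
      calc f (T * x) * (1 + x ^ 2) ≤ f (T * x) * ((1 + (T * x) ^ 2) * (1 + (T ^ 2)⁻¹)) := by
            have := h0 (T * x); gcongr
        _ = (f (T * x) * (1 + (T * x) ^ 2)) * (1 + (T ^ 2)⁻¹) := by ring
        _ ≤ _ := by gcongr; exact hM _
    · intro j hj
      have h3 := hF (j / T) (by
        rw [abs_div, abs_of_pos hT0, lt_div_iff₀ hT0, hT]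
        have : (2 * (m:ℝ)) < |(j:ℝ)| := by exact_mod_cast hj
        field_simp; linarith)
      rw [Real.fourier_eq'] at h3 ⊢
      have h4 := Measure.integral_comp_mul_left (fun v : ℝ => Complex.exp (((-2 * π * inner ℝ v ((j:ℝ) / T) : ℝ) : ℂ) * Complex.I) • (f v : ℂ)) T
      rw [h3, smul_zero] at h4
      rw [← h4]
      congr 1; ext v
      congr 5
      simp; field_simp
  have hlim : Filter.Tendsto (fun m : ℕ => ENNReal.ofReal (f 0 * ((2 / (π * ρ)) ^ N * (s * Real.GammaSeq s m ^ 2)))) Filter.atTop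
      (nhds (ENNReal.ofReal (f 0 * ((2 / (π * ρ)) ^ N * (s * Real.Gamma s ^ 2))))) := by
    apply ENNReal.tendsto_ofReal
    exact ((((Real.GammaSeq_tendsto_Gamma s).pow 2).const_mul s).const_mul _).const_mul _
  refine le_of_tendsto hlim ?_
  filter_upwards [Filter.eventually_gt_atTop 0] with m hm using key m hm

section kern
variable {V : Type*} [NormedAddCommGroup V] [InnerProductSpace ℝ V] [FiniteDimensional ℝ V]
  [MeasurableSpace V] [BorelSpace V]

open SchwartzMap in
lemma fourier_sq_supp (B : SchwartzMap V ℂ) (r : ℝ) (hB : ∀ x, r < ‖x‖ → B x = 0) (ξ : V)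
    (hξ : 2 * r < ‖ξ‖) : 𝓕 (fun x => ((‖𝓕 (B : V → ℂ) x‖ ^ 2 : ℝ) : ℂ)) ξ = 0 := by
  set B' : SchwartzMap V ℂ := B.compSubConstCLM ℂ ξ with hB'
  have h1 : ∀ x, 𝓕 (B' : V → ℂ) x = 𝐞 (-(inner ℝ x ξ)) • 𝓕 (B : V → ℂ) x := by
    intro x
    have := congrFun (VectorFourier.fourierIntegral_comp_add_right 𝐞 (volume : Measure V) (innerₗ V) (B : V → ℂ) (-ξ)) x
    rw [show (-(inner ℝ x ξ)) = innerₗ V (-ξ) x by simp [real_inner_comm]]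
    refine Eq.trans ?_ this
    rw [Real.fourier_eq]
    simp [VectorFourier.fourierIntegral, hB', sub_eq_add_neg]
  have h2 := integral_inner_fourier_fourier B B'
  rw [Real.fourier_eq]
  have h3 : ∀ x, 𝐞 (-(inner ℝ x ξ)) • ((‖𝓕 (B : V → ℂ) x‖ ^ 2 : ℝ) : ℂ) = inner ℂ ((𝓕 B) x) ((𝓕 B') x) := by
    intro x
    rw [SchwartzMap.fourier_coe, SchwartzMap.fourier_coe, h1, Circle.smul_def, Circle.smul_def, inner_smul_right, inner_self_eq_norm_sq_to_K]
    simp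
  simp only [h3]
  rw [h2]
  apply integral_eq_zero_of_ae
  refine Filter.Eventually.of_forall (fun x => ?_)
  by_cases hx : r < ‖x‖
  · simp [hB x hx]
  · have : B' x = 0 := by
      show B (x - ξ) = 0
      apply hB
      have := norm_sub_norm_le ξ x
      rw [norm_sub_rev] at this
      linarith
    simp [this]

lemma exists_bump (r r' : ℝ) (hr' : 0 < r') (hr : r' < r) : ∃ B : SchwartzMap V ℂ, ∃ b : V → ℝ,
    Continuous b ∧ Integrable b ∧ (∀ x, B x = b x) ∧ (∀ x, 0 ≤ b x) ∧ (∀ x, b x ≤ 1) ∧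
    (∀ x ∈ closedBall (0:V) r', b x = 1) ∧ (∀ x, r < ‖x‖ → b x = 0) := by
  let b : ContDiffBump (0 : V) := ⟨r', r, hr', hr⟩
  have hcs : HasCompactSupport (fun x => ((b x : ℝ) : ℂ)) := by
    exact b.hasCompactSupport.comp_left (g := Complex.ofReal) Complex.ofReal_zero
  have hsm : ContDiff ℝ (⊤ : ℕ∞) (fun x => ((b x : ℝ) : ℂ)) :=
    Complex.ofRealCLM.contDiff.comp b.contDiff
  refine ⟨hcs.toSchwartzMap hsm, b, b.continuous, b.integrable, fun x => rfl, fun x => b.nonneg, fun x => b.le_one, ?_, ?_⟩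
  · intro x hx; exact b.one_of_mem_closedBall hx
  · intro x hx
    apply b.zero_of_le_dist
    rw [dist_zero_right]; exact hx.le

end kern

lemma exists_kernel (δ : ℝ) (hδ : 0 < δ) : ∃ s : ℝ → ℝ, Continuous s ∧ (∀ t, 0 ≤ s t) ∧ (∀ t, s t ≤ 1) ∧
    s 0 = 1 ∧ Integrable s ∧ (∃ M, ∀ t, s t * (1 + t ^ 2) ≤ M) ∧
    (∀ τ, δ < |τ| → 𝓕 (fun t => (s t : ℂ)) τ = 0) := by
  obtain ⟨B, b, hbc, hbi, hBb, hb0, hb1, hb2, hb3⟩ := exists_bump (V := ℝ) (δ/2) (δ/4) (by positivity) (by linarith)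
  have hI : 0 < ∫ x, b x := by
    rw [integral_pos_iff_support_of_nonneg hb0 hbi]
    refine lt_of_lt_of_le (measure_ball_pos volume (0:ℝ) (show 0 < δ/4 by positivity)) (measure_mono ?_)
    intro x hx
    simp [hb2 x (ball_subset_closedBall hx)]
  set I := ∫ x, b x
  have hF0 : 𝓕 (B : ℝ → ℂ) 0 = I := by
    rw [Real.fourier_eq']; simp [hBb]; exact integral_ofReal
  have hFle : ∀ t, ‖𝓕 (B : ℝ → ℂ) t‖ ≤ I := by
    intro t
    rw [Real.fourier_eq]
    refine (norm_integral_le_integral_norm _).trans (le_of_eq ?_)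
    congr 1; ext v; simp [hBb, abs_of_nonneg (hb0 v)]
  have hcont : Continuous (𝓕 (B : ℝ → ℂ)) := by
    rw [← SchwartzMap.fourier_coe]; exact SchwartzMap.continuous _
  obtain ⟨C, hC⟩ := (𝓕 B).decay 1 0
  have hdec : ∀ t, ‖𝓕 (B : ℝ → ℂ) t‖ ^ 2 * (1 + t ^ 2) ≤ I ^ 2 + C ^ 2 := by
    intro t
    have h1 := hC.2 t
    rw [SchwartzMap.fourier_coe] at h1
    simp at h1
    have h2 := hFle t
    have h3 : (|t| * ‖𝓕 (B : ℝ → ℂ) t‖) ^ 2 ≤ C ^ 2 := by gcongr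
    have h4 : ‖𝓕 (B : ℝ → ℂ) t‖ ^ 2 ≤ I ^ 2 := by gcongr
    rw [mul_pow, sq_abs] at h3
    linarith
  refine ⟨fun t => ‖𝓕 (B : ℝ → ℂ) t‖ ^ 2 / I ^ 2, by fun_prop, fun t => by positivity, ?_, ?_, ?_, ?_, ?_⟩
  · intro t
    rw [div_le_one (by positivity)]
    have := hFle t
    gcongr
  · show ‖𝓕 (B : ℝ → ℂ) 0‖ ^ 2 / I ^ 2 = 1
    rw [hF0]; simp [hI.ne']
  · apply Integrable.div_const
    have := (integrable_inv_one_add_sq.const_mul (I ^ 2 + C ^ 2))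
    refine this.mono' (by apply Continuous.aestronglyMeasurable; fun_prop) (Filter.Eventually.of_forall (fun t => ?_))
    rw [← div_eq_mul_inv, le_div_iff₀ (by positivity)]
    simpa using hdec t
  · refine ⟨(I ^ 2 + C ^ 2) / I ^ 2, fun t => ?_⟩
    rw [div_mul_eq_mul_div]
    gcongr
    exact hdec t
  · intro τ hτ
    have := fourier_sq_supp B (δ/2) (fun x hx => by simp [hBb, hb3 x hx]) τ (by rw [Real.norm_eq_abs]; linarith)
    rw [Real.fourier_eq'] at this ⊢
    have e : ∀ v : ℝ, Complex.exp (((-2 * π * inner ℝ v τ : ℝ) : ℂ) * Complex.I) • ((‖𝓕 (B : ℝ → ℂ) v‖ ^ 2 / I ^ 2 : ℝ) : ℂ)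
       = (Complex.exp (((-2 * π * inner ℝ v τ : ℝ) : ℂ) * Complex.I) • ((‖𝓕 (B : ℝ → ℂ) v‖ ^ 2 : ℝ) : ℂ)) * ((I:ℂ) ^ 2)⁻¹ := by
      intro v; push_cast; simp only [smul_eq_mul]; ring
    simp only [e]
    rw [integral_mul_const, this, zero_mul]


section low
variable {V : Type*} [NormedAddCommGroup V] [InnerProductSpace ℝ V] [FiniteDimensional ℝ V]
  [MeasurableSpace V] [BorelSpace V]

lemma slice_fourier (g : V → ℂ) (hgi : Integrable g) (hgc : Continuous g) (hg : ∀ ξ, 1 < ‖ξ‖ → g ξ = 0)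
    (s : ℝ → ℝ) (hsc : Continuous s) (hsi : Integrable s) (δ : ℝ)
    (hs : ∀ τ, δ < |τ| → 𝓕 (fun t => (s t : ℂ)) τ = 0) (ω : V) (hω : ‖ω‖ = 1) (τ : ℝ) (hτ : 1 + δ < |τ|) :
    𝓕 (fun t : ℝ => 𝓕⁻ g (t • ω) * (s t : ℂ)) τ = 0 := by
  rw [Real.fourier_eq']
  simp only [Real.fourierInv_eq']
  have e1 : ∀ t : ℝ, Complex.exp (((-2 * π * inner ℝ t τ : ℝ) : ℂ) * Complex.I) •
      ((∫ v : V, Complex.exp (((2 * π * inner ℝ v (t • ω) : ℝ) : ℂ) * Complex.I) • g v) * (s t : ℂ))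
      = ∫ v : V, g v * (Complex.exp (((-2 * π * inner ℝ t (τ - inner ℝ v ω) : ℝ) : ℂ) * Complex.I) • (s t : ℂ)) := by
    intro t
    rw [← integral_mul_const, ← integral_smul]
    congr 1; ext v
    simp only [smul_eq_mul]
    have : Complex.exp (((-2 * π * inner ℝ t (τ - inner ℝ v ω) : ℝ) : ℂ) * Complex.I) =
      Complex.exp (((-2 * π * inner ℝ t τ : ℝ) : ℂ) * Complex.I) *
      Complex.exp (((2 * π * inner ℝ v (t • ω) : ℝ) : ℂ) * Complex.I) := by
      rw [← Complex.exp_add]; congr 1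
      simp [inner_smul_right]; ring
    rw [this]; ring
  simp only [e1]
  rw [integral_integral_swap]
  · apply integral_eq_zero_of_ae
    refine Filter.Eventually.of_forall (fun v => ?_)
    simp only [Pi.zero_apply]
    rw [integral_const_mul]
    by_cases hv : 1 < ‖v‖
    · rw [hg v hv, zero_mul]
    · have h1 : δ < |τ - inner ℝ v ω| := by
        have h2 := abs_real_inner_le_norm v ω
        rw [hω, mul_one] at h2
        have h3 := abs_sub_abs_le_abs_sub τ (inner ℝ v ω)
        linarith
      have := hs _ h1
      rw [Real.fourier_eq'] at this
      rw [this, mul_zero]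
  · have h1 : Integrable (fun p : ℝ × V => (s p.1 : ℂ) * g p.2) := hsi.ofReal.mul_prod hgi
    refine h1.mono (by apply Continuous.aestronglyMeasurable; unfold Function.uncurry; fun_prop) ?_
    refine Filter.Eventually.of_forall (fun p => le_of_eq ?_)
    simp only [Function.uncurry, norm_smul, norm_mul, Complex.norm_exp_ofReal_mul_I]
    ring

structure Adm (F : V → ℝ) : Prop where
  c : Continuous F
  n : ∀ x, 0 ≤ F x
  i : Integrable F
  f : ∀ ξ ∉ closedBall (0 : V) 1, 𝓕 (fun x => (F x : ℂ)) ξ = 0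

lemma adm_line (F : V → ℝ) (hF : Adm F) (N : ℕ) (hN : 0 < N) (ω : V) (hω : ‖ω‖ = 1) :
    ENNReal.ofReal (F 0 * ((2 / π) ^ N * ((N:ℝ)/2 * Real.Gamma ((N:ℝ)/2) ^ 2)))
     ≤ ∫⁻ x : ℝ, ENNReal.ofReal (F (x • ω) * |x| ^ (N - 1)) := by
  set g := 𝓕 (fun x => (F x : ℂ)) with hg
  have hFi : Integrable (fun x => (F x : ℂ)) := hF.i.ofReal
  have hFc : Continuous (fun x => (F x : ℂ)) := Complex.continuous_ofReal.comp hF.c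
  have hgc : Continuous g :=
    VectorFourier.fourierIntegral_continuous Real.continuous_fourierChar (by exact continuous_inner) hFi
  have hg0 : ∀ ξ, 1 < ‖ξ‖ → g ξ = 0 := fun ξ h => hF.f ξ (by simpa using h)
  have hgi : Integrable g := by
    apply hgc.integrable_of_hasCompactSupport
    apply HasCompactSupport.intro (isCompact_closedBall (0:V) 1) hF.f
  have hinv : 𝓕⁻ g = fun x => (F x : ℂ) := hFc.fourierInv_fourier_eq hFi hgi
  have hbd : ∀ x, F x ≤ ∫ ξ, ‖g ξ‖ := by
    intro x
    have h1 : (F x : ℂ) = 𝓕⁻ g x := by rw [hinv]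
    have h2 : F x = ‖(F x : ℂ)‖ := by simp [abs_of_nonneg (hF.n x)]
    rw [h2, h1, Real.fourierInv_eq]
    refine (norm_integral_le_integral_norm _).trans (le_of_eq ?_)
    congr 1; ext v; simp
  have key : ∀ δ : ℝ, 0 < δ → ENNReal.ofReal (F 0 * ((2 / (π * (1 + δ))) ^ N * ((N:ℝ)/2 * Real.Gamma ((N:ℝ)/2) ^ 2)))
     ≤ ∫⁻ x : ℝ, ENNReal.ofReal (F (x • ω) * |x| ^ (N - 1)) := by
    intro δ hδ
    obtain ⟨s, hsc, hs0, hs1, hs00, hsi, ⟨M, hM⟩, hsF⟩ := exists_kernel δ hδ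
    have hc' : Continuous (fun t : ℝ => F (t • ω)) := hF.c.comp (by fun_prop)
    have := line_main N hN (1 + δ) (by positivity) (fun t => F (t • ω) * s t) (hc'.mul hsc)
      (fun x => mul_nonneg (hF.n _) (hs0 _)) ((∫ ξ, ‖g ξ‖) * M) ?_ ?_
    · simp only [zero_smul, hs00, mul_one] at this
      refine this.trans (lintegral_mono (fun x => ENNReal.ofReal_le_ofReal ?_))
      have a := hF.n (x • ω)
      have b := hs1 x
      gcongr
      exact mul_le_of_le_one_right a b
    · intro x
      rw [mul_assoc]
      have := hs0 x
      exact mul_le_mul (hbd _) (hM x) (by positivity) (integral_nonneg (fun _ => norm_nonneg _))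
    · intro τ hτ
      have := slice_fourier g hgi hgc hg0 s hsc hsi δ hsF ω hω τ hτ
      rw [hinv] at this
      simpa using this
  have hlim : Filter.Tendsto (fun δ : ℝ => ENNReal.ofReal (F 0 * ((2 / (π * (1 + δ))) ^ N * ((N:ℝ)/2 * Real.Gamma ((N:ℝ)/2) ^ 2))))
      (nhdsWithin 0 (Set.Ioi 0)) (nhds (ENNReal.ofReal (F 0 * ((2 / (π * (1 + 0))) ^ N * ((N:ℝ)/2 * Real.Gamma ((N:ℝ)/2) ^ 2))))) := by
    apply ENNReal.tendsto_ofReal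
    apply Filter.Tendsto.mono_left _ nhdsWithin_le_nhds
    apply ContinuousAt.tendsto (f := fun δ : ℝ => (F 0 * ((2 / (π * (1 + δ))) ^ N * ((N:ℝ)/2 * Real.Gamma ((N:ℝ)/2) ^ 2))))
    have : π * (1 + (0:ℝ)) ≠ 0 := by simp [Real.pi_ne_zero]
    fun_prop (disch := assumption)
  rw [add_zero, mul_one] at hlim
  refine le_of_tendsto hlim ?_
  filter_upwards [self_mem_nhdsWithin] with δ hδ using key δ hδ

lemma polar_lintegral [Nontrivial V] (G : V → ENNReal) (hG : Measurable G) :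
    ∫⁻ x, G x = ∫⁻ w, (∫⁻ t in Set.Ioi (0:ℝ), ENNReal.ofReal (t ^ (Module.finrank ℝ V - 1)) * G (t • (w : V)))
      ∂(volume : Measure V).toSphere := by
  have h := (volume : Measure V).measurePreserving_homeomorphUnitSphereProd
  have h1 : ∫⁻ x, G x = ∫⁻ x : ({(0)}ᶜ : Set V), G x ∂((volume : Measure V).comap (↑)) := by
    rw [lintegral_subtype_comap (measurableSet_singleton _).compl, restrict_compl_singleton]
  have hm : Measurable (fun p : sphere (0:V) 1 × Set.Ioi (0:ℝ) => G ((p.2 : ℝ) • (p.1 : V))) := by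
    apply hG.comp
    fun_prop
  have h2 : ∀ x : ({(0)}ᶜ : Set V), G x = (fun p : sphere (0:V) 1 × Set.Ioi (0:ℝ) => G ((p.2 : ℝ) • (p.1 : V)))
      (homeomorphUnitSphereProd V x) := by
    intro x
    simp only
    rw [← homeomorphUnitSphereProd_symm_apply_coe]
    simp
  rw [h1]
  simp only [h2]
  rw [h.lintegral_comp hm, lintegral_prod _ hm.aemeasurable]
  congr 1; ext w
  rw [Measure.volumeIoiPow, lintegral_withDensity_eq_lintegral_mul _ (by fun_prop) (by apply hG.comp; fun_prop)]
  simp only [Pi.mul_apply]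
  rw [lintegral_subtype_comap measurableSet_Ioi (fun t : ℝ => ENNReal.ofReal (t ^ (Module.finrank ℝ V - 1)) * G (t • (w : V)))]

lemma adm_lower [Nontrivial V] (F : V → ℝ) (hF : Adm F) (N : ℕ) (hN : 0 < N) (hNV : Module.finrank ℝ V = N) :
    ENNReal.ofReal (F 0 * ((2 / π) ^ N * ((N:ℝ)/2 * Real.Gamma ((N:ℝ)/2) ^ 2))) * (N * volume (ball (0:V) 1))
      ≤ 2 * ∫⁻ x, ENNReal.ofReal (F x) := by
  have hm : Measurable (fun x => ENNReal.ofReal (F x)) := hF.c.measurable.ennreal_ofReal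
  have hm' : Measurable (fun x => ENNReal.ofReal (F (-x))) := hm.comp measurable_neg
  have h1 : 2 * ∫⁻ x, ENNReal.ofReal (F x) = ∫⁻ x, (ENNReal.ofReal (F x) + ENNReal.ofReal (F (-x))) := by
    rw [lintegral_add_left hm, two_mul]
    congr 1
    exact (lintegral_neg_eq_self (fun x => ENNReal.ofReal (F x)) ).symm
  rw [h1, polar_lintegral (fun x => ENNReal.ofReal (F x) + ENNReal.ofReal (F (-x))) (hm.add hm'), ← hNV, ← Measure.toSphere_apply_univ, ← lintegral_const]
  refine lintegral_mono (fun w => ?_)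
  rw [hNV]
  refine (adm_line F hF N hN (w : V) (by simp)).trans (le_of_eq ?_)
  have hc' : Continuous (fun t : ℝ => F (t • (w:V))) := hF.c.comp (by fun_prop)
  have hmm : Measurable (fun t : ℝ => ENNReal.ofReal (F (t • (w:V)) * |t| ^ (N - 1))) := by
    apply Measurable.ennreal_ofReal
    exact (hc'.mul (by fun_prop)).measurable
  rw [← lintegral_add_compl _ (measurableSet_Ioi (a := (0:ℝ))), Set.compl_Ioi, setLIntegral_congr Iio_ae_eq_Iic.symm]
  have h3 : ∫⁻ t in Set.Iio (0:ℝ), ENNReal.ofReal (F (t • (w:V)) * |t| ^ (N - 1)) =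
     ∫⁻ t in Set.Ioi (0:ℝ), ENNReal.ofReal (F ((-t) • (w:V)) * |-t| ^ (N - 1)) := by
    have := (Measure.measurePreserving_neg (volume : Measure ℝ)).setLIntegral_comp_preimage (s := Set.Iio 0) measurableSet_Iio hmm
    rw [← this]
    simp
  rw [h3, ← lintegral_add_left hmm]
  refine setLIntegral_congr_fun measurableSet_Ioi (fun t ht => ?_)
  have ht' : 0 < t := ht
  simp only [abs_neg, neg_smul, abs_of_pos ht']
  rw [mul_add, ← ENNReal.ofReal_mul (by positivity), ← ENNReal.ofReal_mul (by positivity), mul_comm (F _), mul_comm (F _)]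

end low


lemma upper_exists {V : Type*} [NormedAddCommGroup V] [InnerProductSpace ℝ V] [FiniteDimensional ℝ V]
  [MeasurableSpace V] [BorelSpace V] (r' : ℝ) (hr' : 0 < r') (hr : r' < 1/2) :
    ∃ F : V → ℝ, Adm F ∧ F 0 = 1 ∧ ∫ x, F x ≤ 1 / (volume (closedBall (0:V) r')).toReal := by
  obtain ⟨B, b, hbc, hbi, hBb, hb0, hb1, hb2, hb3⟩ := exists_bump (V := V) (1/2) r' hr' hr
  have hvol : (volume (closedBall (0:V) r')).toReal ≤ ∫ x, b x := by
    have h1 : ∫ x, (closedBall (0:V) r').indicator (fun _ => (1:ℝ)) x = (volume (closedBall (0:V) r')).toReal := by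
      rw [integral_indicator measurableSet_closedBall]; simp [Measure.real]
    rw [← h1]
    refine integral_mono ?_ hbi (fun x => ?_)
    · rw [integrable_indicator_iff measurableSet_closedBall]
      exact integrableOn_const (measure_closedBall_lt_top.ne)
    · by_cases hx : x ∈ closedBall (0:V) r'
      · simp only [Set.indicator_of_mem hx, hb2 x hx]; exact le_rfl
      · simp only [Set.indicator_of_notMem hx]; exact hb0 x
  have hvp : 0 < (volume (closedBall (0:V) r')).toReal :=
    ENNReal.toReal_pos (measure_closedBall_pos volume (0:V) hr').ne' measure_closedBall_lt_top.ne
  have hI : 0 < ∫ x, b x := hvp.trans_le hvol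
  set I := ∫ x, b x
  have hF0 : 𝓕 (B : V → ℂ) 0 = I := by
    rw [Real.fourier_eq']; simp [hBb]; exact integral_ofReal
  have hcont : Continuous (𝓕 (B : V → ℂ)) := by
    rw [← SchwartzMap.fourier_coe]; exact SchwartzMap.continuous _
  have hint : Integrable (fun x => ‖𝓕 (B : V → ℂ) x‖ ^ 2) := by
    rw [← SchwartzMap.fourier_coe]
    have := ((𝓕 B).memLp 2).integrable_norm_pow (by norm_num)
    simpa using this
  refine ⟨fun t => ‖𝓕 (B : V → ℂ) t‖ ^ 2 / I ^ 2, ⟨by fun_prop, fun t => by positivity, hint.div_const _, ?_⟩, ?_, ?_⟩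
  · intro τ hτ
    have := fourier_sq_supp B (1/2) (fun x hx => by simp [hBb, hb3 x hx]) τ (by simpa using hτ)
    rw [Real.fourier_eq'] at this ⊢
    have e : ∀ v : V, Complex.exp (((-2 * π * inner ℝ v τ : ℝ) : ℂ) * Complex.I) • ((‖𝓕 (B : V → ℂ) v‖ ^ 2 / I ^ 2 : ℝ) : ℂ)
       = (Complex.exp (((-2 * π * inner ℝ v τ : ℝ) : ℂ) * Complex.I) • ((‖𝓕 (B : V → ℂ) v‖ ^ 2 : ℝ) : ℂ)) * ((I:ℂ) ^ 2)⁻¹ := by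
      intro v; push_cast; simp only [smul_eq_mul]; ring
    simp only [e]
    rw [integral_mul_const, this, zero_mul]
  · show ‖𝓕 (B : V → ℂ) 0‖ ^ 2 / I ^ 2 = 1
    rw [hF0]; simp [hI.ne']
  · rw [integral_div]
    have h1 := SchwartzMap.integral_norm_sq_fourier B
    rw [SchwartzMap.fourier_coe] at h1
    rw [h1]
    have h2 : ∫ x, ‖B x‖ ^ 2 ≤ I := by
      refine integral_mono_of_nonneg (Filter.Eventually.of_forall fun x => by positivity) hbi (Filter.Eventually.of_forall fun x => ?_)
      simp only [hBb, Complex.norm_real, Real.norm_eq_abs, sq_abs]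
      nlinarith [hb0 x, hb1 x]
    calc (∫ x, ‖B x‖ ^ 2) / I ^ 2 ≤ I / I ^ 2 := by gcongr
      _ = 1 / I := by field_simp
      _ ≤ _ := by gcongr

lemma adm_final {N : ℕ} (hN : 0 < N) (F : EuclideanSpace ℝ (Fin N) → ℝ) (hF : Adm F) (h1 : 1 ≤ F 0) :
    2 ^ N / (volume (closedBall (0 : EuclideanSpace ℝ (Fin N)) 1)).toReal ≤ ∫ x, F x := by
  have : Nonempty (Fin N) := ⟨⟨0, hN⟩⟩
  have h := adm_lower F hF N hN (by simp)
  rw [← ofReal_integral_eq_lintegral_ofReal hF.i (Filter.Eventually.of_forall hF.n)] at h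
  rw [EuclideanSpace.volume_ball] at h
  rw [EuclideanSpace.volume_closedBall]
  simp only [Fintype.card_fin, ENNReal.ofReal_one, one_pow, one_mul] at h ⊢
  set v := √π ^ N / Real.Gamma ((N:ℝ)/2 + 1) with hv
  have hG : 0 < Real.Gamma ((N:ℝ)/2) := Real.Gamma_pos_of_pos (by positivity)
  have hGv : Real.Gamma ((N:ℝ)/2 + 1) = (N:ℝ)/2 * Real.Gamma ((N:ℝ)/2) := Real.Gamma_add_one (by positivity)
  have hv0 : 0 < v := by rw [hv, hGv]; positivity
  rw [ENNReal.toReal_ofReal hv0.le]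
  have hI : 0 ≤ ∫ x, F x := integral_nonneg hF.n
  generalize (∫ x, F x) = J at h hI ⊢
  have hn0 := hF.n 0
  generalize F 0 = f0 at h h1 hn0
  have e2 : (2 : ENNReal) = ENNReal.ofReal 2 := by simp
  rw [e2, ← ENNReal.ofReal_natCast, ← ENNReal.ofReal_mul (by positivity), ← ENNReal.ofReal_mul (mul_nonneg hn0 (by positivity)),
    ← ENNReal.ofReal_mul (by positivity), ENNReal.ofReal_le_ofReal_iff (by positivity)] at h
  have hvv : v ^ 2 * ((N:ℝ)/2 * Real.Gamma ((N:ℝ)/2)) ^ 2 = π ^ N := by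
    rw [hv, hGv, div_pow, ← pow_mul, mul_comm N 2, pow_mul, Real.sq_sqrt pi_pos.le]
    field_simp
  have hcc : ((2 / π) ^ N * ((N:ℝ)/2 * Real.Gamma ((N:ℝ)/2) ^ 2)) * (N * v) = 2 * (2 ^ N / v) := by
    rw [div_pow, ← hvv]; field_simp; try ring
  have h3 : 1 * (2 * (2 ^ N / v)) ≤ f0 * (2 * (2 ^ N / v)) := by gcongr
  rw [mul_assoc, hcc] at h
  linarith

/-- `η(B) = 2^N / vol(B)` for the Euclidean unit ball `B ⊂ ℝ^N`, where
`η(B)` is the infimum of `∫ F` over nonzero continuous `F ≥ 0` with `F(0) ≥ 1` and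
Fourier transform supported in `B`. -/
theorem stmt_16 {N : ℕ} (hN : 0 < N) :
    sInf {t : ℝ | ∃ F : EuclideanSpace ℝ (Fin N) → ℝ,
        Continuous F ∧ (∀ x, 0 ≤ F x) ∧ 1 ≤ F 0 ∧ F ≠ 0 ∧ Integrable F volume ∧
        (∀ ξ ∉ closedBall (0 : EuclideanSpace ℝ (Fin N)) 1,
          𝓕 (fun x => (F x : ℂ)) ξ = 0) ∧ t = ∫ x, F x}
      = 2 ^ N / (volume (closedBall (0 : EuclideanSpace ℝ (Fin N)) 1)).toReal := by
  have hex : ∀ r' : ℝ, 0 < r' → r' < 1/2 → ∃ t ∈ {t : ℝ | ∃ F : EuclideanSpace ℝ (Fin N) → ℝ,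
        Continuous F ∧ (∀ x, 0 ≤ F x) ∧ 1 ≤ F 0 ∧ F ≠ 0 ∧ Integrable F volume ∧
        (∀ ξ ∉ closedBall (0 : EuclideanSpace ℝ (Fin N)) 1,
          𝓕 (fun x => (F x : ℂ)) ξ = 0) ∧ t = ∫ x, F x},
        t ≤ 1 / (r' ^ N * (volume (closedBall (0 : EuclideanSpace ℝ (Fin N)) 1)).toReal) := by
    intro r' h0 h1
    obtain ⟨F, hF, hF0, hle⟩ := upper_exists (V := EuclideanSpace ℝ (Fin N)) r' h0 h1
    refine ⟨∫ x, F x, ⟨F, hF.c, hF.n, hF0.ge, ?_, hF.i, hF.f, rfl⟩, ?_⟩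
    · intro h; rw [h] at hF0; simp at hF0
    · rw [Measure.addHaar_closedBall' volume _ h0.le, ENNReal.toReal_mul, ENNReal.toReal_ofReal (by positivity)] at hle
      simpa using hle
  have hlow : ∀ t ∈ {t : ℝ | ∃ F : EuclideanSpace ℝ (Fin N) → ℝ,
        Continuous F ∧ (∀ x, 0 ≤ F x) ∧ 1 ≤ F 0 ∧ F ≠ 0 ∧ Integrable F volume ∧
        (∀ ξ ∉ closedBall (0 : EuclideanSpace ℝ (Fin N)) 1,
          𝓕 (fun x => (F x : ℂ)) ξ = 0) ∧ t = ∫ x, F x},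
        2 ^ N / (volume (closedBall (0 : EuclideanSpace ℝ (Fin N)) 1)).toReal ≤ t := by
    rintro t ⟨F, h1, h2, h3, h4, h5, h6, rfl⟩
    exact adm_final hN F ⟨h1, h2, h5, h6⟩ h3
  have hvp : 0 < (volume (closedBall (0 : EuclideanSpace ℝ (Fin N)) 1)).toReal :=
    ENNReal.toReal_pos (measure_closedBall_pos volume _ one_pos).ne' measure_closedBall_lt_top.ne
  set v := (volume (closedBall (0 : EuclideanSpace ℝ (Fin N)) 1)).toReal
  apply le_antisymm
  · have hlim : Filter.Tendsto (fun r : ℝ => 1 / (r ^ N * v)) (nhdsWithin (1/2) (Set.Iio (1/2))) (nhds (1 / ((1/2) ^ N * v))) := by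
      apply Filter.Tendsto.mono_left _ nhdsWithin_le_nhds
      apply ContinuousAt.tendsto (f := fun r : ℝ => 1 / (r ^ N * v))
      have : ((1/2 : ℝ)) ^ N * v ≠ 0 := by positivity
      fun_prop (disch := assumption)
    have e : 2 ^ N / v = 1 / ((1/2) ^ N * v) := by
      rw [div_pow, one_pow]; field_simp
    rw [e]
    refine ge_of_tendsto hlim ?_
    filter_upwards [Ioo_mem_nhdsLT (show (0:ℝ) < 1/2 by norm_num)] with r hr
    obtain ⟨t, ht, hle⟩ := hex r hr.1 hr.2
    exact (csInf_le ⟨_, hlow⟩ ht).trans hle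
  · obtain ⟨t, ht, -⟩ := hex (1/4) (by norm_num) (by norm_num)
    exact le_csInf ⟨t, ht⟩ hlow
end
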